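/- arXiv:1810.02185 — 2 statements merged into one kernel-verified Lean document; each statement's English description precedes it below -/
import Mathlib

section
/- Let K be an algebraically closed field, G a semigroup, and let A and B be finite-dimensional G-graded K-algebras, each of which is graded-simple. Then A and B are isomorphic as G-graded algebras (i.e., there is a bijective K-linear multiplicative map φ : A → B with φ(A_g) = B_g for every g ∈ G) if and only if A and B satisfy the same G-graded polynomial identities. -/
/-!
STATEMENT 0: Let K be an algebraically closed field, G a semigroup, and let A and B be
finite-dimensional G-graded K-algebras, each of which is graded-simple. Then A and B are
isomorphic as G-graded algebras iff A and B satisfy the same G-graded polynomial identities.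
-/

/-- `I` is a two-sided ideal of the (not necessarily associative or unital) `K`-algebra `A`. -/
def IsIdeal {K A : Type*} [Field K] [NonUnitalNonAssocRing A] [Module K A]
    (I : Submodule K A) : Prop :=
  ∀ a ∈ I, ∀ b : A, a * b ∈ I ∧ b * a ∈ I

/-- `I` is a graded ideal: a two-sided ideal with `I = ⊕_{g ∈ G} (I ∩ A_g)`. -/
def IsGradedIdeal {K G A : Type*} [Field K] [NonUnitalNonAssocRing A] [Module K A]
    (𝒜 : G → Submodule K A) (I : Submodule K A) : Prop :=
  IsIdeal I ∧ I = ⨆ g, I ⊓ 𝒜 g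

/-- `A` is graded-simple: `A·A ≠ 0` and the only graded ideals are `0` and `A`. -/
def IsGradedSimple {K G A : Type*} [Field K] [NonUnitalNonAssocRing A] [Module K A]
    (𝒜 : G → Submodule K A) : Prop :=
  (∃ a b : A, a * b ≠ 0) ∧
    ∀ I : Submodule K A, IsGradedIdeal 𝒜 I → I = ⊥ ∨ I = ⊤

/-- `f`, an element of the free nonassociative `G`-graded algebra `K⟨X^G⟩` (with `X = ℕ`,
realized as the free non-unital non-associative algebra on `ℕ × G`, where `(x, g)` plays the
role of the generator `x^{(g)}`), is a `G`-graded polynomial identity of `A`: every evaluation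
sending each generator `x^{(g)}` into the homogeneous component `A_g` kills `f`. -/
def IsGradedPI {K G A : Type*} [Field K] [NonUnitalNonAssocRing A] [Module K A]
    [SMulCommClass K A A] [IsScalarTower K A A]
    (𝒜 : G → Submodule K A) (f : FreeNonUnitalNonAssocAlgebra K (ℕ × G)) : Prop :=
  ∀ e : ℕ × G → A, (∀ x g, e (x, g) ∈ 𝒜 g) →
    FreeNonUnitalNonAssocAlgebra.lift K e f = 0

/-- `A` and `B` are isomorphic as `G`-graded algebras: there is a bijective `K`-linear
multiplicative map `φ : A → B` with `φ(A_g) = B_g` for every `g`. -/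
def IsGradedIso {K G A B : Type*} [Field K] [NonUnitalNonAssocRing A] [Module K A]
    [NonUnitalNonAssocRing B] [Module K B]
    (𝒜 : G → Submodule K A) (ℬ : G → Submodule K B) : Prop :=
  ∃ φ : A ≃ₗ[K] B, (∀ a b : A, φ (a * b) = φ a * φ b) ∧
    ∀ g, Submodule.map (φ : A →ₗ[K] B) (𝒜 g) = ℬ g

section TensorProducts

open scoped TensorProduct

theorem Subalgebra.eq_top_of_forall_invariant {K V : Type*} [Field K] [IsAlgClosed K]
    [AddCommGroup V] [Module K V] [FiniteDimensional K V] [Nontrivial V]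
    (S : Subalgebra K (Module.End K V))
    (hS : ∀ W : Submodule K V, (∀ T ∈ S, ∀ w ∈ W, T w ∈ W) → W = ⊥ ∨ W = ⊤) : S = ⊤ := by
  have hsimple : IsSimpleModule S V := by
    refine { toIsSimpleOrder := ?_ }
    refine { exists_pair_ne := ⟨⊥, ⊤, bot_ne_top⟩, eq_bot_or_eq_top := fun W => ?_ }
    rcases hS (W.restrictScalars K) fun T hT w hw => W.smul_mem ⟨T, hT⟩ hw with h | h
    · left
      simpa using h
    · right
      simpa using h
  refine eq_top_iff.mpr fun T _ => ?_
  have hend := IsSimpleModule.algebraMap_end_bijective_of_isAlgClosed (A := S) (V := V) K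
  let f : Module.End (Module.End S V) V :=
    { toFun := T
      map_add' := T.map_add
      map_smul' := fun φ v => by
        obtain ⟨c, rfl⟩ := hend.2 φ
        simp }
  classical
  obtain ⟨r, hr⟩ := jacobson_density (R := S) f
    (Finset.univ.image (Module.finBasis K V))
  have : T = r.1 := (Module.finBasis K V).ext fun i =>
    hr _ (Finset.mem_image_of_mem _ (Finset.mem_univ i))
  exact this ▸ r.2

theorem exists_algHom_of_finiteType (K Q : Type*) [Field K] [IsAlgClosed K] [CommRing Q]
    [Algebra K Q] [Algebra.FiniteType K Q] [Nontrivial Q] : Nonempty (Q →ₐ[K] K) := by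
  obtain ⟨m, hm⟩ := Ideal.exists_maximal Q
  let := Ideal.Quotient.field m
  have := finite_of_finite_type_of_isJacobsonRing K (Q ⧸ m)
  have hbij := IsAlgClosed.algebraMap_bijective_of_isIntegral (k := K) (K := Q ⧸ m)
  exact ⟨((AlgEquiv.ofBijective (Algebra.ofId K (Q ⧸ m)) hbij).symm : Q ⧸ m →ₐ[K] K).comp
    (Ideal.Quotient.mkₐ K m)⟩

theorem eq_zero_of_forall_algHom_eq_zero {K Q : Type*} [Field K] [IsAlgClosed K] [CommRing Q]
    [IsDomain Q] [Algebra K Q] [Algebra.FiniteType K Q] {q : Q}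
    (hq : ∀ χ : Q →ₐ[K] K, χ q = 0) : q = 0 := by
  by_contra h
  have : Nontrivial (Localization.Away q) :=
    (IsLocalization.injective (Localization.Away q)
      (powers_le_nonZeroDivisors_of_noZeroDivisors h)).nontrivial
  have : Algebra.FiniteType Q (Localization.Away q) :=
    IsLocalization.finiteType_of_monoid_fg (Submonoid.powers q) _
  have : Algebra.FiniteType K (Localization.Away q) :=
    Algebra.FiniteType.trans (S := Q) inferInstance inferInstance
  obtain ⟨χ⟩ := exists_algHom_of_finiteType K (Localization.Away q)
  have hu := (IsLocalization.Away.algebraMap_isUnit (S := Localization.Away q) q).map χ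
  exact hu.ne_zero (hq (χ.comp (IsScalarTower.toAlgHom K Q _)))

theorem exists_algHom_comp_eq_of_ker_eq {K P Q Q' : Type*} [Field K] [IsAlgClosed K] [CommRing P]
    [CommRing Q] [CommRing Q'] [IsDomain Q] [IsDomain Q'] [Algebra K P] [Algebra K Q]
    [Algebra K Q'] [Algebra.FiniteType K Q] [Algebra.FiniteType K Q']
    (α : P →ₐ[K] Q) (β : P →ₐ[K] Q') (h : ∀ r, α r = 0 ↔ β r = 0) :
    ∃ (χ : Q →ₐ[K] K) (χ' : Q' →ₐ[K] K), ∀ r, χ (α r) = χ' (β r) := by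
  have hker : RingHom.ker α = RingHom.ker β := Ideal.ext h
  let D := P ⧸ RingHom.ker α
  let α' : D →ₐ[K] Q := Ideal.kerLiftAlg α
  let β' : D →ₐ[K] Q' := Ideal.Quotient.liftₐ (RingHom.ker α) β fun a ha => (h a).1 ha
  have hα : Function.Injective α' := Ideal.kerLiftAlg_injective α
  have hβ : Function.Injective β' :=
    (Ideal.injective_lift_iff (f := (β : P →+* Q')) fun a ha => (h a).1 ha).2 hker.symm
  algebraize [α'.toRingHom, β'.toRingHom]
  have : IsScalarTower K D Q := IsScalarTower.of_algHom α'
  have : IsScalarTower K D Q' := IsScalarTower.of_algHom β'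
  have := Algebra.TensorProduct.nontrivial_of_algebraMap_injective_of_isDomain D Q Q' hα hβ
  have : Algebra.FiniteType D Q' := Algebra.FiniteType.of_restrictScalars_finiteType K D Q'
  have : Algebra.FiniteType K (Q ⊗[D] Q') :=
    Algebra.FiniteType.trans (S := Q) inferInstance inferInstance
  obtain ⟨χ⟩ := exists_algHom_of_finiteType K (Q ⊗[D] Q')
  let ι : Q →ₐ[D] Q ⊗[D] Q' := Algebra.TensorProduct.includeLeft
  let ι' : Q' →ₐ[D] Q ⊗[D] Q' := Algebra.TensorProduct.includeRight
  refine ⟨χ.comp (ι.restrictScalars K), χ.comp (ι'.restrictScalars K), fun r => ?_⟩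
  exact congr_arg χ ((ι.commutes (Ideal.Quotient.mk _ r)).trans
    (ι'.commutes (Ideal.Quotient.mk _ r)).symm)

end TensorProducts

section Graded

variable {K G A : Type*} [Field K] [DecidableEq G] [NonUnitalNonAssocRing A] [Module K A]
  (𝒜 : G → Submodule K A) [DirectSum.Decomposition 𝒜]

/-- The projection of a graded vector space onto its homogeneous component of degree `g`. -/
def homogeneousProj (g : G) : Module.End K A :=
  (𝒜 g).subtype ∘ₗ DirectSum.component K G (fun g => 𝒜 g) g ∘ₗ
    (DirectSum.decomposeLinearEquiv 𝒜).toLinearMap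

theorem homogeneousProj_mem (g : G) (a : A) : homogeneousProj 𝒜 g a ∈ 𝒜 g :=
  (DirectSum.decompose 𝒜 a g).2

theorem homogeneousProj_of_mem {g : G} {a : A} (ha : a ∈ 𝒜 g) : homogeneousProj 𝒜 g a = a :=
  DirectSum.decompose_of_mem_same 𝒜 ha

theorem homogeneousProj_of_mem_ne {g h : G} {a : A} (ha : a ∈ 𝒜 h) (hgh : h ≠ g) :
    homogeneousProj 𝒜 g a = 0 :=
  DirectSum.decompose_of_mem_ne 𝒜 ha hgh

theorem eq_iSup_inf_of_homogeneousProj_mem {W : Submodule K A}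
    (hW : ∀ g, ∀ w ∈ W, homogeneousProj 𝒜 g w ∈ W) : W = ⨆ g, W ⊓ 𝒜 g := by
  classical
  refine le_antisymm (fun w hw => ?_) (iSup_le fun g => inf_le_left)
  rw [← DirectSum.sum_support_decompose 𝒜 w]
  exact Submodule.sum_mem _ fun g _ =>
    Submodule.mem_iSup_of_mem g ⟨hW g w hw, (DirectSum.decompose 𝒜 w g).2⟩

theorem exists_homogeneous_basis [FiniteDimensional K A] :
    ∃ (n : ℕ) (deg : Fin n → G) (a : Module.Basis (Fin n) K A), ∀ i, a i ∈ 𝒜 (deg i) := by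
  classical
  let b := (DirectSum.Decomposition.isInternal 𝒜).collectedBasis
    fun g => Module.Basis.ofVectorSpace K (𝒜 g)
  have := Module.Finite.finite_basis b
  obtain ⟨n, ⟨f⟩⟩ := Finite.exists_equiv_fin (Σ g, Module.Basis.ofVectorSpaceIndex K (𝒜 g))
  refine ⟨n, fun i => (f.symm i).1, b.reindex f, fun i => ?_⟩
  rw [Module.Basis.reindex_apply]
  exact DirectSum.IsInternal.collectedBasis_mem _ _ _

variable {𝒜} in
theorem repr_eq_zero_of_mem {n : ℕ} {deg : Fin n → G} (a : Module.Basis (Fin n) K A)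
    (ha : ∀ i, a i ∈ 𝒜 (deg i)) {g : G} {y : A} (hy : y ∈ 𝒜 g) {i : Fin n} (hi : deg i ≠ g) :
    a.repr y i = 0 := by
  have hsum : ∑ j, (if deg j = g then a.repr y j else 0) • a j = y := by
    conv_rhs => rw [← homogeneousProj_of_mem 𝒜 hy, ← a.sum_repr y, map_sum]
    refine Finset.sum_congr rfl fun j _ => ?_
    rw [map_smul]
    split_ifs with h
    · rw [homogeneousProj_of_mem 𝒜 (h ▸ ha j)]
    · rw [homogeneousProj_of_mem_ne 𝒜 (ha j) h, zero_smul, smul_zero]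
  rw [← hsum, a.repr_sum_self, if_neg hi]

end Graded

section MultiplicationOperators

variable {K G C C' ι : Type*} [Field K]
  [NonUnitalNonAssocRing C] [Module K C] [SMulCommClass K C C] [IsScalarTower K C C]
  [NonUnitalNonAssocRing C'] [Module K C'] [SMulCommClass K C' C'] [IsScalarTower K C' C']

/-- Interprets noncommutative polynomials as operators on `C`, the generators being the left and
right multiplications by the elements `ζ i` and the operators `π g`. -/
def operatorHom (π : G → Module.End K C) (ζ : ι → C) :
    FreeAlgebra K ((ι ⊕ ι) ⊕ G) →ₐ[K] Module.End K C :=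
  FreeAlgebra.lift K (Sum.elim (Sum.elim (fun i => LinearMap.mulLeft K (ζ i))
    fun i => LinearMap.mulRight K (ζ i)) π)

theorem map_operatorHom {π : G → Module.End K C} {π' : G → Module.End K C'} (φ : C →ₙₐ[K] C')
    (hφ : ∀ g c, φ (π g c) = π' g (φ c)) (ζ : ι → C) (P : FreeAlgebra K ((ι ⊕ ι) ⊕ G)) (c : C) :
    φ (operatorHom π ζ P c) = operatorHom π' (φ ∘ ζ) P (φ c) := by
  induction P using FreeAlgebra.induction generalizing c with
  | grade0 r => simp [Module.algebraMap_end_apply]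
  | grade1 s => rcases s with (i | i) | g <;> simp [operatorHom, hφ]
  | mul P Q hP hQ => simp [hP, hQ]
  | add P Q hP hQ => simp [hP, hQ]

theorem operatorHom_surjective {K G A : Type*} [Field K] [IsAlgClosed K] [DecidableEq G]
    [NonUnitalNonAssocRing A] [Module K A] [SMulCommClass K A A] [IsScalarTower K A A]
    [FiniteDimensional K A] {𝒜 : G → Submodule K A} [DirectSum.Decomposition 𝒜]
    (hA : IsGradedSimple 𝒜) {ι : Type*} (a : Module.Basis ι K A) :
    Function.Surjective (operatorHom (homogeneousProj 𝒜) a) := by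
  have : Nontrivial A := by
    obtain ⟨x, y, hxy⟩ := hA.1
    exact ⟨_, _, hxy⟩
  rw [← AlgHom.range_eq_top]
  refine Subalgebra.eq_top_of_forall_invariant _ fun W hW => hA.2 W ⟨fun w hw y => ?_, ?_⟩
  · have hl (i : ι) : a i * w ∈ W := by
      simpa [operatorHom] using hW _ ⟨FreeAlgebra.ι K (.inl (.inl i)), rfl⟩ w hw
    have hr (i : ι) : w * a i ∈ W := by
      simpa [operatorHom] using hW _ ⟨FreeAlgebra.ι K (.inl (.inr i)), rfl⟩ w hw
    induction a.mem_span y using Submodule.span_induction with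
    | mem y hy =>
      obtain ⟨i, rfl⟩ := hy
      exact ⟨hr i, hl i⟩
    | zero => simp
    | add x y _ _ hx hy =>
      rw [mul_add, add_mul]
      exact ⟨W.add_mem hx.1 hy.1, W.add_mem hx.2 hy.2⟩
    | smul r x _ hx =>
      rw [mul_smul_comm, smul_mul_assoc]
      exact ⟨W.smul_mem r hx.1, W.smul_mem r hx.2⟩
  · refine eq_iSup_inf_of_homogeneousProj_mem 𝒜 fun g w hw => ?_
    simpa [operatorHom] using hW _ ⟨FreeAlgebra.ι K (.inr g), rfl⟩ w hw

/-- The alternating map obtained by alternating `y₁, …, yₙ` in the composition of the operators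
`u ↦ v (w i (yᵢ) * u)`. -/
def capelliMap {n : ℕ} (v : Module.End K C) (w : Fin n → Module.End K C) :
    C [⋀^Fin n]→ₗ[K] Module.End K C :=
  MultilinearMap.alternatization ((MultilinearMap.mkPiAlgebraFin K n (Module.End K C)).compLinearMap
    fun i => LinearMap.llcomp K C C C v ∘ₗ LinearMap.mul K C ∘ₗ w i)

theorem capelliMap_apply {n : ℕ} (v : Module.End K C) (w : Fin n → Module.End K C) (y : Fin n → C)
    (c : C) : capelliMap v w y c = ∑ σ : Equiv.Perm (Fin n), Equiv.Perm.sign σ •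
      (List.ofFn fun i => v ∘ₗ LinearMap.mul K C (w i (y (σ i)))).prod c := by
  simp only [capelliMap, MultilinearMap.alternatization_apply, LinearMap.sum_apply]
  rfl

omit [SMulCommClass K C C] [IsScalarTower K C C] [SMulCommClass K C' C'] [IsScalarTower K C' C'] in
theorem map_list_prod_ofFn_apply {n : ℕ} (φ : C →ₙₐ[K] C') (T : Fin n → Module.End K C)
    (T' : Fin n → Module.End K C') (h : ∀ i c, φ (T i c) = T' i (φ c)) (c : C) :
    φ ((List.ofFn T).prod c) = (List.ofFn T').prod (φ c) := by
  induction n with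
  | zero => simp
  | succ n ih => simp [List.ofFn_succ, h, ih (fun i => T i.succ) (fun i => T' i.succ) fun i => h _]

theorem list_prod_ofFn_apply_of_eigenvector {n : ℕ} {V : Type*} [AddCommGroup V] [Module K V]
    (T : Fin n → Module.End K V) (r : Fin n → K) (u : V) (h : ∀ i, T i u = r i • u) :
    (List.ofFn T).prod u = (∏ i, r i) • u := by
  induction n with
  | zero => simp
  | succ n ih =>
    simp [List.ofFn_succ, ih (fun i => T i.succ) (fun i => r i.succ) fun i => h _, h,
      Fin.prod_univ_succ, smul_smul, mul_comm]

theorem map_capelliMap {n : ℕ} (φ : C →ₙₐ[K] C') {v : Module.End K C} {v' : Module.End K C'}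
    {w : Fin n → Module.End K C} {w' : Fin n → Module.End K C'} (hv : ∀ c, φ (v c) = v' (φ c))
    (hw : ∀ i c, φ (w i c) = w' i (φ c)) (y : Fin n → C) (c : C) :
    φ (capelliMap v w y c) = capelliMap v' w' (φ ∘ y) (φ c) := by
  rw [capelliMap_apply, capelliMap_apply, map_sum]
  refine Finset.sum_congr rfl fun σ _ => ?_
  simp only [Units.smul_def, map_zsmul]
  congr 1
  exact map_list_prod_ofFn_apply φ _ _ (fun i c => by simp [hv, hw]) c

theorem capelliMap_basis_apply {n : ℕ} {v : Module.End K C} {w : Fin n → Module.End K C}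
    {y : Fin n → C} {c u : C} (hv : v (c * u) = u)
    (hw : ∀ i j, w i (y j) = if j = i then c else 0) : capelliMap v w y u = u := by
  have key (σ : Equiv.Perm (Fin n)) :
      (List.ofFn fun i => v ∘ₗ LinearMap.mul K C (w i (y (σ i)))).prod u =
        (∏ i, (1 : Matrix (Fin n) (Fin n) K) (σ i) i) • u := by
    refine list_prod_ofFn_apply_of_eigenvector _ _ _ fun i => ?_
    by_cases h : σ i = i <;> simp [hw, h, hv, Matrix.one_apply]
  have hdet := Matrix.det_apply (1 : Matrix (Fin n) (Fin n) K)
  rw [Matrix.det_one] at hdet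
  rw [capelliMap_apply]
  simp only [key]
  conv_rhs => rw [← one_smul K u, hdet, Finset.sum_smul]
  exact Finset.sum_congr rfl fun σ _ => (smul_assoc _ _ _).symm

end MultiplicationOperators

section FreeGraded

open FreeNonUnitalNonAssocAlgebra

variable {K G : Type*} [Field K] [Semigroup G] [DecidableEq G]

/-- The degree of a nonassociative word in the generators `x^{(g)}`. -/
def wordDegree : FreeMagma (ℕ × G) →ₙ* G := FreeMagma.lift Prod.snd

variable (K) in
/-- The projection of the free graded algebra onto its component of degree `g`. -/
def freeProj (g : G) : Module.End K (FreeNonUnitalNonAssocAlgebra K (ℕ × G)) where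
  toFun f := MonoidAlgebra.ofCoeff (f.coeff.filter fun m => wordDegree m = g)
  map_add' f f' := by simp [Finsupp.filter_add]
  map_smul' r f := by simp [Finsupp.filter_smul]

theorem freeProj_single (g : G) (m : FreeMagma (ℕ × G)) (r : K) :
    freeProj K g (MonoidAlgebra.single m r) =
      if wordDegree m = g then MonoidAlgebra.single m r else 0 := by
  split_ifs with h
  · exact congr_arg MonoidAlgebra.ofCoeff (Finsupp.filter_single_of_pos _ h)
  · exact congr_arg MonoidAlgebra.ofCoeff (Finsupp.filter_single_of_neg _ h)

variable {A : Type*} [NonUnitalNonAssocRing A] [Module K A] [SMulCommClass K A A]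
  [IsScalarTower K A A] {𝒜 : G → Submodule K A}

omit [DecidableEq G] in
theorem lift_single_mem (hgr : ∀ g h, ∀ a ∈ 𝒜 g, ∀ b ∈ 𝒜 h, a * b ∈ 𝒜 (g * h))
    {e : ℕ × G → A} (he : ∀ x g, e (x, g) ∈ 𝒜 g) (m : FreeMagma (ℕ × G)) :
    lift K e (MonoidAlgebra.single m 1) ∈ 𝒜 (wordDegree m) := by
  induction m with
  | ih1 x => exact (lift_of_apply K e x).symm ▸ he x.1 x.2
  | ih2 m m' hm hm' =>
    have : (MonoidAlgebra.single (m * m') 1 : FreeNonUnitalNonAssocAlgebra K (ℕ × G)) =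
        MonoidAlgebra.single m 1 * MonoidAlgebra.single m' 1 := by simp
    rw [this, map_mul, map_mul]
    exact hgr _ _ _ hm _ hm'

theorem lift_freeProj [DirectSum.Decomposition 𝒜]
    (hgr : ∀ g h, ∀ a ∈ 𝒜 g, ∀ b ∈ 𝒜 h, a * b ∈ 𝒜 (g * h))
    {e : ℕ × G → A} (he : ∀ x g, e (x, g) ∈ 𝒜 g) (g : G)
    (f : FreeNonUnitalNonAssocAlgebra K (ℕ × G)) :
    lift K e (freeProj K g f) = homogeneousProj 𝒜 g (lift K e f) := by
  induction f using MonoidAlgebra.induction_linear with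
  | zero => simp
  | add f f' hf hf' => simp [hf, hf']
  | single m r =>
    have hm : lift K e (MonoidAlgebra.single m r) ∈ 𝒜 (wordDegree m) := by
      have : (MonoidAlgebra.single m r : FreeNonUnitalNonAssocAlgebra K (ℕ × G)) =
        r • MonoidAlgebra.single m 1 := by simp
      rw [this, map_smul]
      exact (𝒜 _).smul_mem r (lift_single_mem hgr he m)
    rw [freeProj_single]
    split_ifs with h
    · exact (homogeneousProj_of_mem 𝒜 (h ▸ hm)).symm
    · rw [map_zero, homogeneousProj_of_mem_ne 𝒜 hm h]

variable {n : ℕ} (deg : Fin n → G)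

variable (K) in
/-- Generators of degrees `deg i` at which alternating polynomials are evaluated. -/
noncomputable def mainVar (i : Fin n) : FreeNonUnitalNonAssocAlgebra K (ℕ × G) :=
  of K ((i : ℕ), deg i)

variable (K) in
/-- Generators of degrees `deg i`, disjoint from `mainVar`, used to form operators. -/
noncomputable def auxVar (i : Fin n) : FreeNonUnitalNonAssocAlgebra K (ℕ × G) :=
  of K (n + (i : ℕ), deg i)

omit [Semigroup G] in
theorem exists_eval [DirectSum.Decomposition 𝒜] {x z : Fin n → A} (hx : ∀ i, x i ∈ 𝒜 (deg i))
    (hz : ∀ i, z i ∈ 𝒜 (deg i)) : ∃ e : ℕ × G → A, (∀ x g, e (x, g) ∈ 𝒜 g) ∧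
      lift K e ∘ mainVar K deg = x ∧ lift K e ∘ auxVar K deg = z := by
  refine ⟨fun y => homogeneousProj 𝒜 y.2 (if h : y.1 < n then x ⟨y.1, h⟩ else
    if h : y.1 - n < n then z ⟨y.1 - n, h⟩ else 0), fun _ g => homogeneousProj_mem 𝒜 g _, ?_, ?_⟩
  · ext i
    simp [mainVar, homogeneousProj_of_mem 𝒜 (hx i)]
  · ext i
    simp [auxVar, homogeneousProj_of_mem 𝒜 (hz i)]

/-- The alternating map of operators on `C` given by operator polynomials `V`, `W i` evaluated
at `ζ`. -/
def operatorCapelli {C : Type*} [NonUnitalNonAssocRing C] [Module K C] [SMulCommClass K C C]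
    [IsScalarTower K C C] (π : G → Module.End K C) (ζ : Fin n → C)
    (V : FreeAlgebra K ((Fin n ⊕ Fin n) ⊕ G)) (W : Fin n → FreeAlgebra K ((Fin n ⊕ Fin n) ⊕ G)) :
    C [⋀^Fin n]→ₗ[K] Module.End K C :=
  capelliMap (operatorHom π ζ V) fun i => operatorHom π ζ (W i)

variable (V : FreeAlgebra K ((Fin n ⊕ Fin n) ⊕ G))
  (W : Fin n → FreeAlgebra K ((Fin n ⊕ Fin n) ⊕ G))

/-- `operatorCapelli` on the free graded algebra, with coefficients `auxVar`. -/
noncomputable def freeCapelli : FreeNonUnitalNonAssocAlgebra K (ℕ × G) [⋀^Fin n]→ₗ[K]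
    Module.End K (FreeNonUnitalNonAssocAlgebra K (ℕ × G)) :=
  operatorCapelli (freeProj K) (auxVar K deg) V W

theorem lift_freeCapelli [DirectSum.Decomposition 𝒜]
    (hgr : ∀ g h, ∀ a ∈ 𝒜 g, ∀ b ∈ 𝒜 h, a * b ∈ 𝒜 (g * h))
    {e : ℕ × G → A} (he : ∀ x g, e (x, g) ∈ 𝒜 g)
    (y : Fin n → FreeNonUnitalNonAssocAlgebra K (ℕ × G))
    (f : FreeNonUnitalNonAssocAlgebra K (ℕ × G)) :
    lift K e (freeCapelli deg V W y f) =
      operatorCapelli (homogeneousProj 𝒜) (lift K e ∘ auxVar K deg) V W (lift K e ∘ y)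
        (lift K e f) :=
  map_capelliMap _ (map_operatorHom _ (lift_freeProj hgr he) _ _)
    (fun _ => map_operatorHom _ (lift_freeProj hgr he) _ _) _ _

theorem lift_freeCapelli_pow [DirectSum.Decomposition 𝒜]
    (hgr : ∀ g h, ∀ a ∈ 𝒜 g, ∀ b ∈ 𝒜 h, a * b ∈ 𝒜 (g * h))
    {e : ℕ × G → A} (he : ∀ x g, e (x, g) ∈ 𝒜 g)
    (y : Fin n → FreeNonUnitalNonAssocAlgebra K (ℕ × G)) (N : ℕ)
    (f : FreeNonUnitalNonAssocAlgebra K (ℕ × G)) :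
    lift K e ((freeCapelli deg V W y ^ N) f) =
      (operatorCapelli (homogeneousProj 𝒜) (lift K e ∘ auxVar K deg) V W (lift K e ∘ y) ^ N)
        (lift K e f) := by
  induction N with
  | zero => simp
  | succ N ih => simp [pow_succ', lift_freeCapelli deg V W hgr he, ih]

/-- The structure constants of an algebra in the basis `b`. -/
noncomputable def structureConstant {A : Type*} [NonUnitalNonAssocRing A] [Module K A]
    (b : Module.Basis (Fin n) K A) (ijk : Fin n × Fin n × Fin n) : K :=
  b.repr (b ijk.1 * b ijk.2.1) ijk.2.2

/-- The operator `θ` on the free graded algebra evaluates to the `N`-th power of the Capelli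
operator times the value of the polynomial `R` at the structure constants, if the main variables
are sent to a basis, and to zero if they are sent to linearly dependent elements. -/
def RepresentsStructurePolynomial (𝒜 : G → Submodule K A) [DirectSum.Decomposition 𝒜]
    (R : MvPolynomial (Fin n × Fin n × Fin n) K) (N : ℕ)
    (θ : Module.End K (FreeNonUnitalNonAssocAlgebra K (ℕ × G))) : Prop :=
  ∀ e : ℕ × G → A, (∀ x g, e (x, g) ∈ 𝒜 g) → ∀ f,
    (∀ b : Module.Basis (Fin n) K A, lift K e ∘ mainVar K deg = b →
      lift K e (θ f) = MvPolynomial.eval (structureConstant b) R •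
        (operatorCapelli (homogeneousProj 𝒜) (lift K e ∘ auxVar K deg) V W b ^ N) (lift K e f)) ∧
    (¬ LinearIndependent K (lift K e ∘ mainVar K deg) → lift K e (θ f) = 0)

namespace RepresentsStructurePolynomial

variable {deg V W} [DirectSum.Decomposition 𝒜]

theorem const (hgr : ∀ g h, ∀ a ∈ 𝒜 g, ∀ b ∈ 𝒜 h, a * b ∈ 𝒜 (g * h)) (r : K) {N : ℕ}
    (hN : N ≠ 0) :
    RepresentsStructurePolynomial deg V W 𝒜 (MvPolynomial.C r) N
      (r • freeCapelli deg V W (mainVar K deg) ^ N) := by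
  refine fun e he f => ⟨fun b hb => ?_, fun hdep => ?_⟩
  · rw [LinearMap.smul_apply, map_smul, lift_freeCapelli_pow deg V W hgr he, hb,
      MvPolynomial.eval_C]
  · rw [LinearMap.smul_apply, map_smul, lift_freeCapelli_pow deg V W hgr he,
      AlternatingMap.map_linearDependent _ _ hdep, zero_pow hN, LinearMap.zero_apply, smul_zero]

omit [Semigroup G] in
theorem add {R R' : MvPolynomial (Fin n × Fin n × Fin n) K} {N : ℕ}
    {θ θ' : Module.End K (FreeNonUnitalNonAssocAlgebra K (ℕ × G))}
    (h : RepresentsStructurePolynomial deg V W 𝒜 R N θ)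
    (h' : RepresentsStructurePolynomial deg V W 𝒜 R' N θ') :
    RepresentsStructurePolynomial deg V W 𝒜 (R + R') N (θ + θ') := by
  refine fun e he f => ⟨fun b hb => ?_, fun hdep => ?_⟩
  · rw [LinearMap.add_apply, map_add, (h e he f).1 b hb, (h' e he f).1 b hb, map_add, add_smul]
  · rw [LinearMap.add_apply, map_add, (h e he f).2 hdep, (h' e he f).2 hdep, add_zero]

theorem mul_X (hgr : ∀ g h, ∀ a ∈ 𝒜 g, ∀ b ∈ 𝒜 h, a * b ∈ 𝒜 (g * h))
    {R : MvPolynomial (Fin n × Fin n × Fin n) K} {N : ℕ}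
    {θ : Module.End K (FreeNonUnitalNonAssocAlgebra K (ℕ × G))}
    (h : RepresentsStructurePolynomial deg V W 𝒜 R N θ) (i j k : Fin n) :
    RepresentsStructurePolynomial deg V W 𝒜 (R * MvPolynomial.X (i, j, k)) (N + 1)
      (freeCapelli deg V W
        (Function.update (mainVar K deg) k (mainVar K deg i * mainVar K deg j)) * θ) := by
  refine fun e he f => ⟨fun b hb => ?_, fun hdep => ?_⟩
  · have hupd : lift K e ∘
        Function.update (mainVar K deg) k (mainVar K deg i * mainVar K deg j) =
          Function.update b k (b i * b j) := by
      rw [Function.comp_update, hb, map_mul, ← hb]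
      rfl
    have hcap (Φ : A [⋀^Fin n]→ₗ[K] Module.End K A) :
        Φ (Function.update b k (b i * b j)) = structureConstant b (i, j, k) • Φ b := by
      conv_lhs => rw [← b.sum_repr (b i * b j), AlternatingMap.map_update_sum]
      rw [Finset.sum_eq_single k]
      · rw [AlternatingMap.map_update_smul, Function.update_eq_self]
        rfl
      · intro l _ hl
        rw [AlternatingMap.map_update_smul, AlternatingMap.map_update_self _ _ hl.symm, smul_zero]
      · simp
    rw [Module.End.mul_apply, lift_freeCapelli deg V W hgr he, hupd, hcap, (h e he f).1 b hb,
      map_mul, MvPolynomial.eval_X, pow_succ', Module.End.mul_apply, LinearMap.smul_apply, map_smul,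
      smul_smul, mul_comm]
  · rw [Module.End.mul_apply, lift_freeCapelli deg V W hgr he, (h e he f).2 hdep, map_zero]

end RepresentsStructurePolynomial

end FreeGraded

section Transfer

open FreeNonUnitalNonAssocAlgebra

variable {K G A B : Type*} [Field K] [IsAlgClosed K] [Semigroup G] [DecidableEq G]
  [NonUnitalNonAssocRing A] [Module K A] [SMulCommClass K A A] [IsScalarTower K A A]
  [NonUnitalNonAssocRing B] [Module K B] [SMulCommClass K B B] [IsScalarTower K B B]
  {𝒜 : G → Submodule K A} {ℬ : G → Submodule K B}
  [DirectSum.Decomposition 𝒜] [DirectSum.Decomposition ℬ]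
  {n : ℕ} {deg : Fin n → G}

omit [Semigroup G] in
theorem exists_operatorCapelli_apply_eq [FiniteDimensional K A] (hA : IsGradedSimple 𝒜)
    (a : Module.Basis (Fin n) K A) :
    ∃ (V : FreeAlgebra K ((Fin n ⊕ Fin n) ⊕ G)) (W : Fin n → FreeAlgebra K ((Fin n ⊕ Fin n) ⊕ G))
      (q : Fin n), operatorCapelli (homogeneousProj 𝒜) a V W a (a q) = a q := by
  obtain ⟨p, q, hpq⟩ : ∃ p q, a p * a q ≠ 0 := by
    by_contra! h
    obtain ⟨x, y, hxy⟩ := hA.1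
    have : LinearMap.mul K A = 0 := a.ext fun i => a.ext fun j => h i j
    exact hxy (LinearMap.congr_fun₂ this x y)
  obtain ⟨φ, hφ⟩ : ∃ φ : Module.Dual K A, φ (a p * a q) ≠ 0 := by
    by_contra! h
    exact hpq ((Module.forall_dual_apply_eq_zero_iff K _).1 h)
  obtain ⟨V, hV⟩ := operatorHom_surjective hA a
    (LinearMap.toSpanSingleton K A (a q) ∘ₗ ((φ (a p * a q))⁻¹ • φ))
  choose W hW using fun i => operatorHom_surjective hA a
    (a.constr K fun j => if j = i then a p else 0)
  refine ⟨V, W, q, capelliMap_basis_apply (c := a p) (by simp [hV, hφ]) fun i j => ?_⟩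
  rw [hW, Module.Basis.constr_basis]

omit [IsAlgClosed K] in
theorem not_isGradedPI_freeCapelli_pow
    (hgrA : ∀ g h, ∀ a ∈ 𝒜 g, ∀ b ∈ 𝒜 h, a * b ∈ 𝒜 (g * h))
    {a : Module.Basis (Fin n) K A} (ha : ∀ i, a i ∈ 𝒜 (deg i))
    {V : FreeAlgebra K ((Fin n ⊕ Fin n) ⊕ G)} {W : Fin n → FreeAlgebra K ((Fin n ⊕ Fin n) ⊕ G)}
    {q : Fin n} (h : operatorCapelli (homogeneousProj 𝒜) a V W a (a q) = a q) (N : ℕ) :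
    ¬ IsGradedPI 𝒜 ((freeCapelli deg V W (mainVar K deg) ^ N) (auxVar K deg q)) := by
  intro hPI
  obtain ⟨e, he, hx, hz⟩ := exists_eval deg ha ha
  have hN : (operatorCapelli (homogeneousProj 𝒜) a V W a ^ N) (a q) = a q := by
    clear hPI
    induction N with
    | zero => simp
    | succ N ih => rw [pow_succ, Module.End.mul_apply, h, ih]
  have h0 := hPI e he
  rw [lift_freeCapelli_pow deg V W hgrA he, hx, hz, show lift K e (auxVar K deg q) = a q from
    congr_fun hz q, hN] at h0
  exact a.ne_zero q h0

theorem exists_linearIndependent_of_isGradedPI [FiniteDimensional K A]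
    (hgrA : ∀ g h, ∀ a ∈ 𝒜 g, ∀ b ∈ 𝒜 h, a * b ∈ 𝒜 (g * h))
    (hgrB : ∀ g h, ∀ a ∈ ℬ g, ∀ b ∈ ℬ h, a * b ∈ ℬ (g * h)) (hA : IsGradedSimple 𝒜)
    (hBA : ∀ f : FreeNonUnitalNonAssocAlgebra K (ℕ × G), IsGradedPI ℬ f → IsGradedPI 𝒜 f)
    (a : Module.Basis (Fin n) K A) (ha : ∀ i, a i ∈ 𝒜 (deg i)) :
    ∃ b : Fin n → B, LinearIndependent K b ∧ ∀ i, b i ∈ ℬ (deg i) := by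
  obtain ⟨V, W, q, h⟩ := exists_operatorCapelli_apply_eq hA a
  have hB := mt (hBA _) (not_isGradedPI_freeCapelli_pow hgrA ha h 1)
  rw [IsGradedPI] at hB
  push Not at hB
  obtain ⟨e, he, hne⟩ := hB
  refine ⟨lift K e ∘ mainVar K deg, ?_, fun i => ?_⟩
  · by_contra hdep
    rw [lift_freeCapelli_pow deg V W hgrB he, AlternatingMap.map_linearDependent _ _ hdep] at hne
    simp at hne
  · simpa [mainVar] using he i (deg i)

omit [IsAlgClosed K] in
theorem AlternatingMap.eq_det_smul_basis {M N : Type*} [AddCommGroup M] [Module K M]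
    [AddCommGroup N] [Module K N] (Φ : M [⋀^Fin n]→ₗ[K] N) (b : Module.Basis (Fin n) K M)
    (y : Fin n → M) : Φ y = b.det y • Φ b := by
  have : Φ = (LinearMap.toSpanSingleton K N (Φ b)).compAlternatingMap b.det := by
    refine b.ext_alternating fun v hv => ?_
    let σ := Equiv.ofBijective v (Finite.injective_iff_bijective.mp hv)
    have hσ : (fun i => b (v i)) = b ∘ σ := rfl
    simp [hσ, AlternatingMap.map_perm, b.det_self]
  exact AlternatingMap.congr_fun this y

omit [IsAlgClosed K] in
theorem AlternatingMap.pow_map_basis_apply_ne_zero {M : Type*} [AddCommGroup M] [Module K M]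
    (Φ : M [⋀^Fin n]→ₗ[K] Module.End K M) (b : Module.Basis (Fin n) K M) {y : Fin n → M} {N : ℕ}
    {u : M} (h : (Φ y ^ N) u ≠ 0) : (Φ b ^ N) u ≠ 0 := by
  rw [Φ.eq_det_smul_basis b, smul_pow, LinearMap.smul_apply] at h
  exact right_ne_zero_of_smul h

omit [IsAlgClosed K] in
theorem exists_representsStructurePolynomial
    (hgrA : ∀ g h, ∀ a ∈ 𝒜 g, ∀ b ∈ 𝒜 h, a * b ∈ 𝒜 (g * h))
    (hgrB : ∀ g h, ∀ a ∈ ℬ g, ∀ b ∈ ℬ h, a * b ∈ ℬ (g * h))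
    (V : FreeAlgebra K ((Fin n ⊕ Fin n) ⊕ G)) (W : Fin n → FreeAlgebra K ((Fin n ⊕ Fin n) ⊕ G))
    (R : MvPolynomial (Fin n × Fin n × Fin n) K) :
    ∃ N₀, ∀ N ≥ N₀, ∃ θ, RepresentsStructurePolynomial deg V W 𝒜 R N θ ∧
      RepresentsStructurePolynomial deg V W ℬ R N θ := by
  induction R using MvPolynomial.induction_on with
  | C r => exact ⟨1, fun N hN => ⟨_, .const hgrA r (by lia), .const hgrB r (by lia)⟩⟩
  | add R R' h h' =>
    obtain ⟨N₀, h⟩ := h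
    obtain ⟨N₀', h'⟩ := h'
    refine ⟨max N₀ N₀', fun N hN => ?_⟩
    obtain ⟨θ, hA, hB⟩ := h N (le_of_max_le_left hN)
    obtain ⟨θ', hA', hB'⟩ := h' N (le_of_max_le_right hN)
    exact ⟨θ + θ', hA.add hA', hB.add hB'⟩
  | mul_X R ijk h =>
    obtain ⟨N₀, h⟩ := h
    refine ⟨N₀ + 1, fun N hN => ?_⟩
    obtain ⟨N, rfl⟩ := Nat.exists_eq_add_one_of_ne_zero (n := N) (by lia)
    obtain ⟨θ, hA, hB⟩ := h N (by lia)
    exact ⟨_, hA.mul_X hgrA ijk.1 ijk.2.1 ijk.2.2, hB.mul_X hgrB ijk.1 ijk.2.1 ijk.2.2⟩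

theorem eval_structureConstant_eq_zero_of_isGradedPI [FiniteDimensional K A]
    (hgrA : ∀ g h, ∀ a ∈ 𝒜 g, ∀ b ∈ 𝒜 h, a * b ∈ 𝒜 (g * h))
    (hgrB : ∀ g h, ∀ a ∈ ℬ g, ∀ b ∈ ℬ h, a * b ∈ ℬ (g * h)) (hA : IsGradedSimple 𝒜)
    (hPI : ∀ f : FreeNonUnitalNonAssocAlgebra K (ℕ × G), IsGradedPI 𝒜 f ↔ IsGradedPI ℬ f)
    (a : Module.Basis (Fin n) K A) (ha : ∀ i, a i ∈ 𝒜 (deg i))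
    {R : MvPolynomial (Fin n × Fin n × Fin n) K}
    (hR : ∀ x : Module.Basis (Fin n) K A, (∀ i, x i ∈ 𝒜 (deg i)) →
      MvPolynomial.eval (structureConstant x) R = 0)
    (b : Module.Basis (Fin n) K B) (hb : ∀ i, b i ∈ ℬ (deg i)) :
    MvPolynomial.eval (structureConstant b) R = 0 := by
  obtain ⟨V, W, q, h⟩ := exists_operatorCapelli_apply_eq hA a
  obtain ⟨N, hN⟩ := exists_representsStructurePolynomial (deg := deg) hgrA hgrB V W R
  obtain ⟨θ, hθA, hθB⟩ := hN N le_rfl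
  have hθ : IsGradedPI 𝒜 (θ (auxVar K deg q)) := by
    intro e he
    by_cases hind : LinearIndependent K (lift K e ∘ mainVar K deg)
    · let x := basisOfLinearIndependentOfCardEqFinrank' _ hind
        (Module.finrank_eq_card_basis a).symm
      have hx : lift K e ∘ mainVar K deg = x :=
        (coe_basisOfLinearIndependentOfCardEqFinrank' _ _ _).symm
      rw [(hθA e he _).1 x hx, hR x fun i => ?_, zero_smul]
      rw [← hx]
      simpa [mainVar] using he i (deg i)
    · exact (hθA e he _).2 hind
  have hB := mt (hPI _).2 (not_isGradedPI_freeCapelli_pow hgrA ha h N)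
  rw [IsGradedPI] at hB
  push Not at hB
  obtain ⟨e, he, hne⟩ := hB
  obtain ⟨e', he', hx, hz⟩ := exists_eval deg (𝒜 := ℬ) (x := b) (z := lift K e ∘ auxVar K deg) hb
    fun i => by simpa [auxVar] using he (n + i) (deg i)
  have hzero := (hPI _).1 hθ e' he'
  rw [(hθB e' he' _).1 b hx, hz, show lift K e' (auxVar K deg q) = lift K e (auxVar K deg q) from
    congr_fun hz q] at hzero
  rw [lift_freeCapelli_pow deg V W hgrB he] at hne
  exact (smul_eq_zero.1 hzero).resolve_right (AlternatingMap.pow_map_basis_apply_ne_zero _ b hne)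

end Transfer

section BaseChange

variable {K G A : Type*} [Field K] [NonUnitalNonAssocRing A] [Module K A] {n : ℕ}

/-- The structure constants obtained from `γ` by the change of basis `U`. -/
noncomputable def changeStructureConstant {Q : Type*} [CommRing Q] [Algebra K Q]
    (U : Matrix (Fin n) (Fin n) Q) (γ : Fin n × Fin n × Fin n → K) (ijk : Fin n × Fin n × Fin n) :
    Q :=
  ∑ l, U⁻¹ ijk.2.2 l * ∑ r, ∑ s, U r ijk.1 * U s ijk.2.1 * algebraMap K Q (γ (r, s, l))

theorem map_changeStructureConstant {Q Q' : Type*} [CommRing Q] [CommRing Q'] [Algebra K Q]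
    [Algebra K Q'] (χ : Q →ₐ[K] Q') {U : Matrix (Fin n) (Fin n) Q} (hU : IsUnit U.det)
    (γ : Fin n × Fin n × Fin n → K) (ijk : Fin n × Fin n × Fin n) :
    χ (changeStructureConstant U γ ijk) = changeStructureConstant (U.map χ) γ ijk := by
  have hinv : (U.map χ)⁻¹ = U⁻¹.map χ := by
    refine Matrix.inv_eq_right_inv ?_
    rw [← Matrix.map_mul, Matrix.mul_nonsing_inv U hU]
    exact Matrix.map_one χ (map_zero χ) (map_one χ)
  simp [changeStructureConstant, hinv]

theorem exists_basis_structureConstant_eq [SMulCommClass K A A] [IsScalarTower K A A]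
    (a : Module.Basis (Fin n) K A) {U : Matrix (Fin n) (Fin n) K} (hU : IsUnit U.det) :
    ∃ x : Module.Basis (Fin n) K A, (∀ j, x j = ∑ i, U i j • a i) ∧
      structureConstant x = changeStructureConstant U (structureConstant a) := by
  let φ := Matrix.toLinOfInv a a (Matrix.mul_nonsing_inv U hU) (Matrix.nonsing_inv_mul U hU)
  have hx (j : Fin n) : a.map φ j = ∑ i, U i j • a i := by
    simp [φ, Matrix.toLin_self]
  refine ⟨a.map φ, hx, funext fun ijk => ?_⟩
  have hrepr (y : A) (k : Fin n) : (a.map φ).repr y k = ∑ l, U⁻¹ k l * a.repr y l := by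
    have : φ.symm y = Matrix.toLin a a U⁻¹ y := rfl
    rw [Module.Basis.map_repr, LinearEquiv.trans_apply, this, Matrix.repr_toLin]
    rfl
  rw [structureConstant, hrepr, changeStructureConstant, hx, hx]
  refine Finset.sum_congr rfl fun l _ => ?_
  simp [Finset.sum_mul_sum, smul_mul_smul_comm, structureConstant]

variable (K) [DecidableEq G] (deg : Fin n → G)

/-- The generic matrix preserving the grading of a vector space with a basis of degrees `deg`. -/
noncomputable def genericMatrix : Matrix (Fin n) (Fin n) (MvPolynomial (Fin n × Fin n) K) :=
  Matrix.of fun i j => if deg i = deg j then MvPolynomial.X (i, j) else 0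

theorem genericMatrix_map_aeval {U : Matrix (Fin n) (Fin n) K}
    (hU : ∀ i j, deg i ≠ deg j → U i j = 0) :
    (genericMatrix K deg).map (MvPolynomial.aeval fun ij => U ij.1 ij.2) = U := by
  ext i j
  by_cases h : deg i = deg j
  · simp [genericMatrix, h]
  · simp [genericMatrix, h, hU i j h]

theorem det_genericMatrix_ne_zero : (genericMatrix K deg).det ≠ 0 := by
  intro h
  have h1 := genericMatrix_map_aeval K deg (U := 1) fun i j hij =>
    Matrix.one_apply_ne fun h => hij (congr_arg deg h)
  have h2 := congr_arg Matrix.det h1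
  rw [← AlgHom.mapMatrix_apply, ← AlgHom.map_det, h, map_zero, Matrix.det_one] at h2
  exact zero_ne_one h2

/-- The coordinate ring of the group of invertible matrices preserving the grading. -/
abbrev GenericRing : Type _ := Localization.Away (genericMatrix K deg).det

/-- The generic invertible matrix preserving the grading. -/
noncomputable def genericUnit : Matrix (Fin n) (Fin n) (GenericRing K deg) :=
  (genericMatrix K deg).map (algebraMap _ (GenericRing K deg))

theorem isUnit_det_genericUnit : IsUnit (genericUnit K deg).det := by
  rw [genericUnit, ← RingHom.mapMatrix_apply, ← RingHom.map_det]
  exact IsLocalization.Away.algebraMap_isUnit _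

instance : IsDomain (GenericRing K deg) :=
  IsLocalization.isDomain_localization
    (powers_le_nonZeroDivisors_of_noZeroDivisors (det_genericMatrix_ne_zero K deg))

instance : Algebra.FiniteType K (GenericRing K deg) :=
  have : Algebra.FiniteType (MvPolynomial (Fin n × Fin n) K) (GenericRing K deg) :=
    IsLocalization.finiteType_of_monoid_fg (Submonoid.powers (genericMatrix K deg).det) _
  Algebra.FiniteType.trans (S := MvPolynomial (Fin n × Fin n) K) inferInstance inferInstance

/-- The specialization to the structure constants in a generic homogeneous basis. -/
noncomputable def genericStructure (γ : Fin n × Fin n × Fin n → K) :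
    MvPolynomial (Fin n × Fin n × Fin n) K →ₐ[K] GenericRing K deg :=
  MvPolynomial.aeval (changeStructureConstant (genericUnit K deg) γ)

variable {K deg}

theorem algHom_genericStructure (χ : GenericRing K deg →ₐ[K] K) (γ : Fin n × Fin n × Fin n → K)
    (R : MvPolynomial (Fin n × Fin n × Fin n) K) :
    χ (genericStructure K deg γ R) =
      MvPolynomial.eval (changeStructureConstant ((genericUnit K deg).map χ) γ) R := by
  have : χ.comp (genericStructure K deg γ) =
      MvPolynomial.aeval (changeStructureConstant ((genericUnit K deg).map χ) γ) :=
    MvPolynomial.algHom_ext fun ijk => by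
      simp [genericStructure, map_changeStructureConstant χ (isUnit_det_genericUnit K deg)]
  rw [← AlgHom.comp_apply, this, MvPolynomial.aeval_eq_eval]

variable [SMulCommClass K A A] [IsScalarTower K A A] {𝒜 : G → Submodule K A}
  (a : Module.Basis (Fin n) K A) (ha : ∀ i, a i ∈ 𝒜 (deg i))
include ha

theorem exists_homogeneous_basis_of_algHom (χ : GenericRing K deg →ₐ[K] K) :
    ∃ x : Module.Basis (Fin n) K A, (∀ i, x i ∈ 𝒜 (deg i)) ∧
      ∀ R, χ (genericStructure K deg (structureConstant a) R) =
        MvPolynomial.eval (structureConstant x) R := by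
  have hU : IsUnit ((genericUnit K deg).map χ).det := by
    rw [← AlgHom.mapMatrix_apply, ← AlgHom.map_det]
    exact (isUnit_det_genericUnit K deg).map χ
  obtain ⟨x, hx, hs⟩ := exists_basis_structureConstant_eq a hU
  refine ⟨x, fun j => ?_, fun R => by rw [algHom_genericStructure, hs]⟩
  rw [hx]
  refine Submodule.sum_mem _ fun i _ => ?_
  by_cases h : deg i = deg j
  · exact h ▸ (𝒜 _).smul_mem _ (ha i)
  · simp [genericUnit, genericMatrix, h]

theorem exists_algHom_of_homogeneous_basis [DirectSum.Decomposition 𝒜]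
    (x : Module.Basis (Fin n) K A) (hx : ∀ i, x i ∈ 𝒜 (deg i)) :
    ∃ χ : GenericRing K deg →ₐ[K] K,
      ∀ R, χ (genericStructure K deg (structureConstant a) R) =
        MvPolynomial.eval (structureConstant x) R := by
  have hgr (i j : Fin n) (hij : deg i ≠ deg j) : a.toMatrix x i j = 0 :=
    repr_eq_zero_of_mem a ha (hx j) hij
  have hmap := genericMatrix_map_aeval K deg hgr
  have hunit : IsUnit (a.toMatrix x).det := a.isUnit_det x
  let ε : MvPolynomial (Fin n × Fin n) K →ₐ[K] K :=
    MvPolynomial.aeval fun ij => a.toMatrix x ij.1 ij.2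
  have hε : IsUnit (ε (genericMatrix K deg).det) := by
    rw [AlgHom.map_det, AlgHom.mapMatrix_apply, hmap]
    exact hunit
  let χ : GenericRing K deg →ₐ[K] K := IsLocalization.liftAlgHom
    (M := Submonoid.powers (genericMatrix K deg).det) (f := ε) (by
      rintro ⟨_, m, rfl⟩
      simpa using hε.pow m)
  have hχ : (genericUnit K deg).map χ = a.toMatrix x := by
    rw [← hmap, genericUnit, Matrix.map_map]
    congr 1
    ext p
    exact IsLocalization.lift_eq _ p
  obtain ⟨x', hx', hs⟩ := exists_basis_structureConstant_eq a hunit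
  have : x' = x := Module.Basis.eq_of_apply_eq fun j => by
    rw [hx', ← a.sum_toMatrix_smul_self x j]
  refine ⟨χ, fun R => by rw [algHom_genericStructure, hχ, ← hs, this]⟩

end BaseChange

section Isomorphism

variable {K G A B : Type*} [Field K] [DecidableEq G]
  [NonUnitalNonAssocRing A] [Module K A] [SMulCommClass K A A] [IsScalarTower K A A]
  [NonUnitalNonAssocRing B] [Module K B] [SMulCommClass K B B] [IsScalarTower K B B]
  {𝒜 : G → Submodule K A} {ℬ : G → Submodule K B}
  [DirectSum.Decomposition 𝒜] [DirectSum.Decomposition ℬ]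
  {n : ℕ} {deg : Fin n → G}

theorem isGradedIso_of_structureConstant_eq (a : Module.Basis (Fin n) K A)
    (ha : ∀ i, a i ∈ 𝒜 (deg i)) (b : Module.Basis (Fin n) K B) (hb : ∀ i, b i ∈ ℬ (deg i))
    (h : structureConstant a = structureConstant b) : IsGradedIso 𝒜 ℬ := by
  let φ := a.equiv b (Equiv.refl _)
  have hφ (i : Fin n) : φ (a i) = b i := by simp [φ]
  have hproj (g : G) (y : A) : φ (homogeneousProj 𝒜 g y) = homogeneousProj ℬ g (φ y) := by
    have : φ.toLinearMap ∘ₗ homogeneousProj 𝒜 g = homogeneousProj ℬ g ∘ₗ φ.toLinearMap := by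
      refine a.ext fun i => ?_
      simp only [LinearMap.comp_apply, LinearEquiv.coe_coe, hφ]
      by_cases hg : deg i = g
      · rw [homogeneousProj_of_mem 𝒜 (hg ▸ ha i), homogeneousProj_of_mem ℬ (hg ▸ hb i), hφ]
      · rw [homogeneousProj_of_mem_ne 𝒜 (ha i) hg, homogeneousProj_of_mem_ne ℬ (hb i) hg, map_zero]
    exact LinearMap.congr_fun this y
  refine ⟨φ, fun y y' => ?_, fun g => le_antisymm ?_ fun y hy => ?_⟩
  · have : (LinearMap.mul K A).compr₂ φ.toLinearMap =
        (LinearMap.mul K B).compl₁₂ φ.toLinearMap φ.toLinearMap := by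
      refine a.ext fun i => a.ext fun j => ?_
      simp only [LinearMap.compr₂_apply, LinearMap.compl₁₂_apply, LinearMap.mul_apply',
        LinearEquiv.coe_coe, hφ]
      rw [← a.sum_repr (a i * a j), ← b.sum_repr (b i * b j), map_sum]
      refine Finset.sum_congr rfl fun k _ => ?_
      rw [map_smul, hφ]
      exact congr_arg (· • b k) (congr_fun h (i, j, k))
    exact LinearMap.congr_fun₂ this y y'
  · rintro _ ⟨y, hy, rfl⟩
    rw [← homogeneousProj_of_mem 𝒜 hy]
    exact (hproj g y).symm ▸ homogeneousProj_mem ℬ g _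
  · refine ⟨homogeneousProj 𝒜 g (φ.symm y), homogeneousProj_mem 𝒜 g _, ?_⟩
    exact (hproj g _).trans (by rw [φ.apply_symm_apply, homogeneousProj_of_mem ℬ hy])

omit [DecidableEq G] [DirectSum.Decomposition 𝒜] [DirectSum.Decomposition ℬ] in
theorem IsGradedIso.isGradedPI_of_isGradedPI (h : IsGradedIso 𝒜 ℬ)
    {f : FreeNonUnitalNonAssocAlgebra K (ℕ × G)} (hf : IsGradedPI ℬ f) : IsGradedPI 𝒜 f := by
  obtain ⟨φ, hmul, hmap⟩ := h
  intro e he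
  let ψ : A →ₙₐ[K] B := { φ.toLinearMap with
    map_zero' := map_zero φ
    map_mul' := hmul }
  have h0 := hf (φ ∘ e) fun x g => hmap g ▸ Submodule.mem_map_of_mem (he x g)
  have hcomp : FreeNonUnitalNonAssocAlgebra.lift K (φ ∘ e) =
      ψ.comp (FreeNonUnitalNonAssocAlgebra.lift K e) :=
    FreeNonUnitalNonAssocAlgebra.hom_ext K fun x => by simp [ψ]
  rw [hcomp] at h0
  exact φ.map_eq_zero_iff.1 h0

omit [DecidableEq G] [DirectSum.Decomposition 𝒜] [DirectSum.Decomposition ℬ]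
  [SMulCommClass K A A] [IsScalarTower K A A] [SMulCommClass K B B] [IsScalarTower K B B] in
theorem IsGradedIso.symm (h : IsGradedIso 𝒜 ℬ) : IsGradedIso ℬ 𝒜 := by
  obtain ⟨φ, hmul, hmap⟩ := h
  refine ⟨φ.symm, fun y y' => φ.injective (by simp [hmul]), fun g => ?_⟩
  rw [← hmap g, ← Submodule.map_comp]
  simp

end Isomorphism

theorem gradedSimple_iso_iff_same_gradedIdentities
    (K G A B : Type*) [Field K] [IsAlgClosed K] [Semigroup G] [DecidableEq G]
    [NonUnitalNonAssocRing A] [Module K A] [SMulCommClass K A A] [IsScalarTower K A A]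
    [FiniteDimensional K A]
    [NonUnitalNonAssocRing B] [Module K B] [SMulCommClass K B B] [IsScalarTower K B B]
    [FiniteDimensional K B]
    (𝒜 : G → Submodule K A) (ℬ : G → Submodule K B)
    [DirectSum.Decomposition 𝒜] [DirectSum.Decomposition ℬ]
    (hgrA : ∀ (g h : G), ∀ a ∈ 𝒜 g, ∀ b ∈ 𝒜 h, a * b ∈ 𝒜 (g * h))
    (hgrB : ∀ (g h : G), ∀ a ∈ ℬ g, ∀ b ∈ ℬ h, a * b ∈ ℬ (g * h))
    (hA : IsGradedSimple 𝒜) (hB : IsGradedSimple ℬ) :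
    IsGradedIso 𝒜 ℬ ↔
      (∀ f : FreeNonUnitalNonAssocAlgebra K (ℕ × G), IsGradedPI 𝒜 f ↔ IsGradedPI ℬ f) := by
  refine ⟨fun h f => ⟨h.symm.isGradedPI_of_isGradedPI, h.isGradedPI_of_isGradedPI⟩, fun hPI => ?_⟩
  obtain ⟨n, deg, a, ha⟩ := exists_homogeneous_basis 𝒜
  obtain ⟨m, deg', b', hb'⟩ := exists_homogeneous_basis ℬ
  obtain ⟨b₀, hind, hb⟩ := exists_linearIndependent_of_isGradedPI hgrA hgrB hA
    (fun f => (hPI f).2) a ha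
  obtain ⟨a₀, hind', -⟩ := exists_linearIndependent_of_isGradedPI hgrB hgrA hB
    (fun f => (hPI f).1) b' hb'
  have hcard : n = Module.finrank K B := by
    refine le_antisymm (by simpa using hind.fintype_card_le_finrank) ?_
    rw [Module.finrank_eq_card_basis b']
    refine hind'.fintype_card_le_finrank.trans ?_
    simp [Module.finrank_eq_card_basis a]
  obtain ⟨b, rfl⟩ : ∃ b : Module.Basis (Fin n) K B, ⇑b = b₀ :=
    ⟨basisOfLinearIndependentOfCardEqFinrank' _ hind (by simpa using hcard), by simp⟩
  obtain ⟨χ, χ', hχ⟩ := exists_algHom_comp_eq_of_ker_eq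
    (genericStructure K deg (structureConstant a)) (genericStructure K deg (structureConstant b))
    fun R => by
      constructor <;> intro hR <;> refine eq_zero_of_forall_algHom_eq_zero (K := K) fun χ => ?_
      · obtain ⟨y, hy, hχy⟩ := exists_homogeneous_basis_of_algHom b hb χ
        rw [hχy]
        refine eval_structureConstant_eq_zero_of_isGradedPI hgrA hgrB hA hPI a ha ?_ y hy
        intro x hx
        obtain ⟨χ', hχ'⟩ := exists_algHom_of_homogeneous_basis a ha x hx
        rw [← hχ', hR, map_zero]
      · obtain ⟨x, hx, hχx⟩ := exists_homogeneous_basis_of_algHom a ha χ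
        rw [hχx]
        refine eval_structureConstant_eq_zero_of_isGradedPI hgrB hgrA hB (fun f => (hPI f).symm) b
          hb ?_ x hx
        intro y hy
        obtain ⟨χ', hχ'⟩ := exists_algHom_of_homogeneous_basis b hb y hy
        rw [← hχ', hR, map_zero]
  obtain ⟨x, hx, hχx⟩ := exists_homogeneous_basis_of_algHom a ha χ
  obtain ⟨y, hy, hχy⟩ := exists_homogeneous_basis_of_algHom b hb χ'
  refine isGradedIso_of_structureConstant_eq x hx y hy (funext fun ijk => ?_)
  simpa [hχx, hχy] using hχ (MvPolynomial.X ijk)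
end

section
/- Let K be an algebraically closed field, G a semigroup, and let A and B be finite-dimensional G-graded K-algebras, each of which is graded-prime. Then A and B are isomorphic as G-graded algebras if and only if A and B satisfy the same G-graded polynomial identities. -/
/-- `A` is graded-prime: for any two graded ideals `I`, `J`, if `I·J = 0` then `I = 0`
or `J = 0`. -/
def IsGradedPrime {K G A : Type*} [Field K] [NonUnitalNonAssocRing A] [Module K A]
    (𝒜 : G → Submodule K A) : Prop :=
  ∀ I J : Submodule K A, IsGradedIdeal 𝒜 I → IsGradedIdeal 𝒜 J →
    (∀ a ∈ I, ∀ b ∈ J, a * b = 0) → I = ⊥ ∨ J = ⊥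

namespace GradedPrime

open Module

/-- The action on `C` of words in the left and right multiplications by the elements `y i`. -/
noncomputable def mulAct (K : Type*) {ι C : Type*} [Field K] [NonUnitalNonAssocRing C] [Module K C]
    [SMulCommClass K C C] [IsScalarTower K C C] (y : ι → C) :
    FreeAlgebra K (ι ⊕ ι) →ₐ[K] Module.End K C :=
  FreeAlgebra.lift K
    (Sum.elim (fun i => LinearMap.mulLeft K (y i)) (fun i => LinearMap.mulRight K (y i)))

/-- The data of a twisted multiplication: two words to be applied to the factors of a product,
one to be applied to the product, and words `leaf i` to be applied to the `i`-th variable. -/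
structure Words (K ι : Type*) [Field K] where
  /-- applied to products -/
  out : FreeAlgebra K (ι ⊕ ι)
  /-- applied to left factors -/
  left : FreeAlgebra K (ι ⊕ ι)
  /-- applied to right factors -/
  right : FreeAlgebra K (ι ⊕ ι)
  /-- applied to variables -/
  leaf : ι → FreeAlgebra K (ι ⊕ ι)

section Polymorphic

variable {K ι : Type*} [Field K]
variable {C : Type*} [NonUnitalNonAssocRing C] [Module K C] [SMulCommClass K C C]
  [IsScalarTower K C C]
variable {D : Type*} [NonUnitalNonAssocRing D] [Module K D] [SMulCommClass K D D]
  [IsScalarTower K D D]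

theorem map_mulAct (φ : C →ₙₐ[K] D) (y : ι → C) (w : FreeAlgebra K (ι ⊕ ι)) (c : C) :
    φ (mulAct K y w c) = mulAct K (fun i => φ (y i)) w (φ c) := by
  induction w using FreeAlgebra.induction generalizing c with
  | grade0 r => simp [Algebra.algebraMap_eq_smul_one]
  | grade1 x => rcases x with i | i <;> simp [mulAct]
  | mul a b ha hb => simp [ha, hb]
  | add a b ha hb => simp [ha, hb]

/-- The twisted multiplication attached to `W`. -/
noncomputable def Words.mul (W : Words K ι) (y : ι → C) (u v : C) : C :=
  mulAct K y W.out (mulAct K y W.left u * mulAct K y W.right v)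

variable (W : Words K ι)

theorem Words.add_mul (y : ι → C) (u u' v : C) :
    W.mul y (u + u') v = W.mul y u v + W.mul y u' v := by
  simp [Words.mul, _root_.add_mul]

theorem Words.mul_add (y : ι → C) (u v v' : C) :
    W.mul y u (v + v') = W.mul y u v + W.mul y u v' := by
  simp [Words.mul, _root_.mul_add]

theorem Words.smul_mul (y : ι → C) (r : K) (u v : C) :
    W.mul y (r • u) v = r • W.mul y u v := by
  simp [Words.mul, smul_mul_assoc]

theorem Words.mul_smul (y : ι → C) (r : K) (u v : C) :
    W.mul y u (r • v) = r • W.mul y u v := by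
  simp [Words.mul, mul_smul_comm]

theorem Words.zero_mul (y : ι → C) (v : C) : W.mul y 0 v = 0 := by
  simp [Words.mul]

theorem Words.mul_zero (y : ι → C) (v : C) : W.mul y v 0 = 0 := by
  simp [Words.mul]

theorem Words.map_mul (φ : C →ₙₐ[K] D) (y : ι → C) (u v : C) :
    φ (W.mul y u v) = W.mul (fun i => φ (y i)) (φ u) (φ v) := by
  simp [Words.mul, map_mulAct]

/-- The twisted product of the variables `x i` for `i` in a list, starting with `y i₀`. -/
noncomputable def Words.prod (i₀ : ι) (y : ι → C) : List ι → (ι → C) → C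
  | [], _ => mulAct K y (W.leaf i₀) (y i₀)
  | i :: l, x => W.mul y (Words.prod i₀ y l x) (mulAct K y (W.leaf i) (x i))

theorem Words.map_prod (φ : C →ₙₐ[K] D) (i₀ : ι) (y : ι → C) (l : List ι) (x : ι → C) :
    φ (W.prod i₀ y l x) = W.prod i₀ (fun i => φ (y i)) l (fun i => φ (x i)) := by
  induction l with
  | nil => simp [Words.prod, map_mulAct]
  | cons i l ih => simp [Words.prod, Words.map_mul, map_mulAct, ih]

theorem Words.prod_eq_zero (i₀ : ι) (y : ι → C) {l : List ι} {x : ι → C} {i : ι} (hi : i ∈ l)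
    (h : mulAct K y (W.leaf i) (x i) = 0) : W.prod i₀ y l x = 0 := by
  induction l with
  | nil => simp at hi
  | cons j l ih =>
    rcases List.mem_cons.1 hi with rfl | hi
    · simp [Words.prod, h, Words.mul_zero]
    · simp [Words.prod, ih hi, Words.zero_mul]

variable [DecidableEq ι]

theorem Words.prod_update_of_notMem (i₀ : ι) (y : ι → C) {l : List ι} (x : ι → C) {i : ι}
    (hi : i ∉ l) (u : C) : W.prod i₀ y l (Function.update x i u) = W.prod i₀ y l x := by
  induction l with
  | nil => rfl
  | cons j l ih =>
    simp only [List.mem_cons, not_or] at hi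
    simp [Words.prod, ih hi.2, Function.update_of_ne (Ne.symm hi.1)]

theorem Words.prod_update_add (i₀ : ι) (y : ι → C) {l : List ι} (hl : l.Nodup) (x : ι → C) {i : ι}
    (hi : i ∈ l) (u v : C) : W.prod i₀ y l (Function.update x i (u + v)) =
      W.prod i₀ y l (Function.update x i u) + W.prod i₀ y l (Function.update x i v) := by
  induction l with
  | nil => simp at hi
  | cons j l ih =>
    rw [List.nodup_cons] at hl
    by_cases hij : i = j
    · subst hij
      simp [Words.prod, Words.prod_update_of_notMem _ _ _ _ hl.1, Words.mul_add]
    · have hi' : i ∈ l := by simpa [hij] using hi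
      simp [Words.prod, ih hl.2 hi', Words.add_mul, Function.update_of_ne (Ne.symm hij)]

theorem Words.prod_update_smul (i₀ : ι) (y : ι → C) {l : List ι} (hl : l.Nodup) (x : ι → C) {i : ι}
    (hi : i ∈ l) (r : K) (u : C) : W.prod i₀ y l (Function.update x i (r • u)) =
      r • W.prod i₀ y l (Function.update x i u) := by
  induction l with
  | nil => simp at hi
  | cons j l ih =>
    rw [List.nodup_cons] at hl
    by_cases hij : i = j
    · subst hij
      simp [Words.prod, Words.prod_update_of_notMem _ _ _ _ hl.1, Words.mul_smul]
    · have hi' : i ∈ l := by simpa [hij] using hi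
      simp [Words.prod, ih hl.2 hi', Words.smul_mul, Function.update_of_ne (Ne.symm hij)]

variable [Fintype ι] {G : Type*} [DecidableEq G] (deg : ι → G)

/-- The alternating sum of `W.prod` over the degree-preserving permutations of the variables. -/
noncomputable def Words.alt (i₀ : ι) (y x : ι → C) : C :=
  ∑ σ : Equiv.Perm ι, if ∀ i, deg (σ i) = deg i then
    Equiv.Perm.sign σ • W.prod i₀ y Finset.univ.toList (fun i => x (σ i)) else 0

theorem Words.map_alt (φ : C →ₙₐ[K] D) (i₀ : ι) (y x : ι → C) :
    φ (W.alt deg i₀ y x) = W.alt deg i₀ (fun i => φ (y i)) (fun i => φ (x i)) := by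
  simp only [Words.alt, map_sum]
  refine Finset.sum_congr rfl fun σ _ => ?_
  split_ifs
  · rw [← W.map_prod]
    rcases Int.units_eq_one_or (Equiv.Perm.sign σ) with h | h <;> simp [h]
  · simp

/-- Iterated twisted multiplication by `W.alt`. -/
noncomputable def Words.pow (i₀ : ι) (y x : ι → C) : ℕ → C
  | 0 => W.alt deg i₀ y x
  | d + 1 => W.mul y (Words.pow i₀ y x d) (W.alt deg i₀ y x)

theorem Words.map_pow (φ : C →ₙₐ[K] D) (i₀ : ι) (y x : ι → C) (d : ℕ) :
    φ (W.pow deg i₀ y x d) = W.pow deg i₀ (fun i => φ (y i)) (fun i => φ (x i)) d := by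
  induction d with
  | zero => exact W.map_alt deg φ i₀ y x
  | succ d ih => simp [Words.pow, Words.map_mul, Words.map_alt, ih]

theorem Words.pow_eq_zero (i₀ : ι) (y x : ι → C) (h : W.alt deg i₀ y x = 0) (d : ℕ) :
    W.pow deg i₀ y x d = 0 := by
  induction d with
  | zero => exact h
  | succ d ih => simp [Words.pow, ih, Words.zero_mul]

theorem Words.exists_pow_eq_smul (i₀ : ι) (y x x' : ι → C) {r : K} (hr : r ≠ 0)
    (h : W.alt deg i₀ y x' = r • W.alt deg i₀ y x) (d : ℕ) :
    ∃ s : K, s ≠ 0 ∧ W.pow deg i₀ y x' d = s • W.pow deg i₀ y x d := by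
  induction d with
  | zero => exact ⟨r, hr, h⟩
  | succ d ih =>
    obtain ⟨s, hs, h'⟩ := ih
    refine ⟨r * s, mul_ne_zero hr hs, ?_⟩
    simp [Words.pow, h, h', Words.smul_mul, Words.mul_smul, smul_smul]

variable {i₀ : ι} {a : ι → C} {z : C}

omit [Fintype ι] [DecidableEq G] in
theorem Words.prod_eq (hz : W.mul a z z = z)
    (hleaf : ∀ i j, deg i = deg j → mulAct K a (W.leaf i) (a j) = if i = j then z else 0)
    (l : List ι) : W.prod i₀ a l a = z := by
  induction l with
  | nil => simp [Words.prod, hleaf i₀ i₀ rfl]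
  | cons i l ih => simp [Words.prod, hleaf i i rfl, ih, hz]

theorem Words.alt_eq (hz : W.mul a z z = z)
    (hleaf : ∀ i j, deg i = deg j → mulAct K a (W.leaf i) (a j) = if i = j then z else 0) :
    W.alt deg i₀ a a = z := by
  rw [Words.alt, Finset.sum_eq_single 1]
  · simp [W.prod_eq deg hz hleaf]
  · intro σ _ hσ
    split_ifs with h
    · obtain ⟨i, hi⟩ : ∃ i, σ i ≠ i := by
        by_contra! hc
        exact hσ (Equiv.ext hc)
      rw [W.prod_eq_zero i₀ a (i := i) (by simp), smul_zero]
      rw [hleaf i (σ i) (h i).symm, if_neg (Ne.symm hi)]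
    · rfl
  · simp

theorem Words.pow_eq (hz : W.mul a z z = z)
    (hleaf : ∀ i j, deg i = deg j → mulAct K a (W.leaf i) (a j) = if i = j then z else 0)
    (d : ℕ) : W.pow deg i₀ a a d = z := by
  induction d with
  | zero => exact W.alt_eq deg hz hleaf
  | succ d ih => simp [Words.pow, W.alt_eq deg hz hleaf, ih, hz]

end Polymorphic

section Graded

variable {K ι G C : Type*} [Field K] [DecidableEq G]
  [NonUnitalNonAssocRing C] [Module K C] (𝒞 : G → Submodule K C) [DirectSum.Decomposition 𝒞]

/-- The projection onto the homogeneous component of degree `g`. -/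
noncomputable def proj (g : G) : C →ₗ[K] C :=
  (𝒞 g).subtype ∘ₗ DirectSum.component K G (fun g => 𝒞 g) g ∘ₗ
    (DirectSum.decomposeLinearEquiv 𝒞).toLinearMap

theorem proj_mem (g : G) (c : C) : proj 𝒞 g c ∈ 𝒞 g := (DirectSum.decompose 𝒞 c g).2

theorem proj_of_mem {g : G} {c : C} (h : c ∈ 𝒞 g) : proj 𝒞 g c = c :=
  DirectSum.decompose_of_mem_same 𝒞 h

theorem proj_of_mem_ne {g h : G} {c : C} (hc : c ∈ 𝒞 g) (hgh : g ≠ h) : proj 𝒞 h c = 0 :=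
  DirectSum.decompose_of_mem_ne 𝒞 hc hgh

theorem proj_of_mem_eq_ite {g : G} (h : G) {c : C} (hc : c ∈ 𝒞 g) :
    proj 𝒞 h c = if g = h then c else 0 := by
  split_ifs with hgh
  · exact proj_of_mem 𝒞 (hgh ▸ hc)
  · exact proj_of_mem_ne 𝒞 hc hgh

theorem eq_zero_of_proj (c : C) (h : ∀ g, proj 𝒞 g c = 0) : c = 0 := by
  classical
  rw [← DirectSum.sum_support_decompose 𝒞 c]
  exact Finset.sum_eq_zero fun g _ => h g

theorem exists_proj_ne_zero {c : C} (h : c ≠ 0) : ∃ g, proj 𝒞 g c ≠ 0 := by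
  by_contra! hc
  exact h (eq_zero_of_proj 𝒞 c hc)

theorem sum_proj [Fintype ι] {deg : ι → G} {b : Module.Basis ι K C} (hb : ∀ i, b i ∈ 𝒞 (deg i))
    (c : C) : ∑ g ∈ Finset.univ.image deg, proj 𝒞 g c = c := by
  have : ∑ g ∈ Finset.univ.image deg, proj 𝒞 g = LinearMap.id := by
    refine b.ext fun i => ?_
    simp only [LinearMap.sum_apply, LinearMap.id_apply]
    rw [Finset.sum_eq_single (deg i)]
    · exact proj_of_mem 𝒞 (hb i)
    · intro g _ hg
      exact proj_of_mem_ne 𝒞 (hb i) hg.symm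
    · simp
  simpa using LinearMap.congr_fun this c

/-- A homogeneous vector only involves basis vectors of its own degree. -/
theorem coeff_eq_zero [Fintype ι] {deg : ι → G} {x : ι → C} (hx : ∀ i, x i ∈ 𝒞 (deg i))
    (hli : LinearIndependent K x) {g : G} {r : ι → K} (h : ∑ i, r i • x i ∈ 𝒞 g) {i : ι}
    (hi : deg i ≠ g) : r i = 0 := by
  have h1 := proj_of_mem 𝒞 h
  simp only [map_sum, map_smul, proj_of_mem_eq_ite 𝒞 g (hx _)] at h1
  rw [← sub_eq_zero, ← Finset.sum_sub_distrib] at h1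
  have h2 : ∑ i, (if deg i = g then 0 else - r i) • x i = 0 := by
    rw [← h1]
    refine Finset.sum_congr rfl fun j _ => ?_
    split_ifs <;> simp
  have h3 := Fintype.linearIndependent_iff.1 hli _ h2 i
  simpa [hi] using h3

theorem exists_homogeneous_basis [FiniteDimensional K C] : ∃ (deg : Fin (Module.finrank K C) → G)
    (b : Module.Basis (Fin (Module.finrank K C)) K C), ∀ i, b i ∈ 𝒞 (deg i) := by
  classical
  have h := DirectSum.Decomposition.isInternal 𝒞
  let b := h.collectedBasis fun g => Module.Free.chooseBasis K (𝒞 g)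
  have := Module.Finite.finite_basis b
  have := Fintype.ofFinite (Σ g, Module.Free.ChooseBasisIndex K (𝒞 g))
  let e := Fintype.equivFinOfCardEq (Module.finrank_eq_card_basis b).symm
  refine ⟨fun i => (e.symm i).1, b.reindex e, fun i => ?_⟩
  rw [Module.Basis.reindex_apply]
  exact h.collectedBasis_mem _ _

variable [SMulCommClass K C C] [IsScalarTower K C C] [DecidableEq ι] [Fintype ι]
  (W : Words K ι) (deg : ι → G)

/-- `W.prod` precomposed with the projections, as a multilinear map. -/
noncomputable def Words.multilinear (i₀ : ι) (y : ι → C) : MultilinearMap K (fun _ : ι => C) C where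
  toFun x := W.prod i₀ y Finset.univ.toList (fun i => proj 𝒞 (deg i) (x i))
  map_update_add' x i u v := by
    have key : ∀ u, (fun j => proj 𝒞 (deg j) (Function.update x i u j)) =
        Function.update (fun j => proj 𝒞 (deg j) (x j)) i (proj 𝒞 (deg i) u) := by
      intro u
      ext j
      rcases eq_or_ne j i with rfl | h <;> simp [*]
    simp only [key, map_add]
    exact W.prod_update_add i₀ y (Finset.nodup_toList _) _ (by simp) _ _
  map_update_smul' x i r u := by
    have key : ∀ u, (fun j => proj 𝒞 (deg j) (Function.update x i u j)) =
        Function.update (fun j => proj 𝒞 (deg j) (x j)) i (proj 𝒞 (deg i) u) := by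
      intro u
      ext j
      rcases eq_or_ne j i with rfl | h <;> simp [*]
    simp only [key, map_smul]
    exact W.prod_update_smul i₀ y (Finset.nodup_toList _) _ (by simp) _ _

theorem Words.alternatization_eq (i₀ : ι) (y : ι → C) {x : ι → C} (hx : ∀ i, x i ∈ 𝒞 (deg i)) :
    MultilinearMap.alternatization (W.multilinear 𝒞 deg i₀ y) x = W.alt deg i₀ y x := by
  rw [MultilinearMap.alternatization_apply, Words.alt]
  refine Finset.sum_congr rfl fun σ _ => ?_
  change Equiv.Perm.sign σ • W.prod i₀ y Finset.univ.toList
    (fun i => proj 𝒞 (deg i) (x (σ i))) = _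
  split_ifs with h
  · congr 2
    ext i
    exact proj_of_mem 𝒞 (h i ▸ hx (σ i))
  · push Not at h
    obtain ⟨i, hi⟩ := h
    rw [W.prod_eq_zero i₀ y (i := i) (by simp), smul_zero]
    rw [proj_of_mem_ne 𝒞 (hx _) hi, map_zero]

variable {deg}

theorem Words.alt_eq_zero {i₀ : ι} {y x : ι → C} (hx : ∀ i, x i ∈ 𝒞 (deg i))
    (h : ¬ LinearIndependent K x) : W.alt deg i₀ y x = 0 := by
  rw [← W.alternatization_eq 𝒞 deg i₀ y hx]
  exact AlternatingMap.map_linearDependent _ _ h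

theorem Words.alt_update {i₀ : ι} {y x : ι → C} (hx : ∀ i, x i ∈ 𝒞 (deg i)) {r : ι → K} {k : ι}
    (h : ∑ i, r i • x i ∈ 𝒞 (deg k)) :
    W.alt deg i₀ y (Function.update x k (∑ i, r i • x i)) = r k • W.alt deg i₀ y x := by
  have hx' : ∀ j, Function.update x k (∑ i, r i • x i) j ∈ 𝒞 (deg j) := by
    intro j
    rcases eq_or_ne j k with rfl | hj <;> simp [*]
  rw [← W.alternatization_eq 𝒞 deg i₀ y hx, ← W.alternatization_eq 𝒞 deg i₀ y hx']
  rw [AlternatingMap.map_update_sum, Finset.sum_eq_single k]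
  · rw [AlternatingMap.map_update_smul, Function.update_eq_self]
  · intro j _ hj
    rw [AlternatingMap.map_update_smul, AlternatingMap.map_update_self _ _ hj.symm, smul_zero]
  · simp

theorem Words.exists_alt_eq_smul {i₀ : ι} {y : ι → C} (b b' : Module.Basis ι K C)
    (hb : ∀ i, b i ∈ 𝒞 (deg i)) (hb' : ∀ i, b' i ∈ 𝒞 (deg i)) :
    ∃ r : K, r ≠ 0 ∧ W.alt deg i₀ y b' = r • W.alt deg i₀ y b := by
  have key : MultilinearMap.alternatization (W.multilinear 𝒞 deg i₀ y) =
      b.det.smulRight (W.alt deg i₀ y b) := by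
    refine Module.Basis.ext_alternating b fun i h => ?_
    let σ : Equiv.Perm ι := Equiv.ofBijective i (Finite.injective_iff_bijective.1 h)
    change MultilinearMap.alternatization (W.multilinear 𝒞 deg i₀ y) (b ∘ σ) =
      b.det (b ∘ σ) • W.alt deg i₀ y b
    rw [← W.alternatization_eq 𝒞 deg i₀ y hb, AlternatingMap.map_perm, AlternatingMap.map_perm,
      Module.Basis.det_self, smul_assoc, one_smul]
  refine ⟨b.det b', (b.isUnit_det b').ne_zero, ?_⟩
  rw [← W.alternatization_eq 𝒞 deg i₀ y hb', key]
  rfl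

end Graded

section Transfer

variable {K ι G : Type*} [Field K]

/-- The evaluation of a polynomial in two families of variables. -/
noncomputable def ev {C : Type*} [NonUnitalNonAssocRing C] [Module K C] [SMulCommClass K C C]
    [IsScalarTower K C C] (x y : ι → C) : FreeNonUnitalNonAssocAlgebra K (ι ⊕ ι) →ₙₐ[K] C :=
  FreeNonUnitalNonAssocAlgebra.lift K (Sum.elim x y)

/-- The variables of the first family. -/
noncomputable def varX (K : Type*) {ι : Type*} [Field K] (i : ι) :
    FreeNonUnitalNonAssocAlgebra K (ι ⊕ ι) :=
  FreeNonUnitalNonAssocAlgebra.of K (Sum.inl i)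

/-- The variables of the second family. -/
noncomputable def varY (K : Type*) {ι : Type*} [Field K] (i : ι) :
    FreeNonUnitalNonAssocAlgebra K (ι ⊕ ι) :=
  FreeNonUnitalNonAssocAlgebra.of K (Sum.inr i)

/-- Every polynomial in variables of degrees `deg` vanishing on `A` vanishes on `B`. -/
def VanishingTransfers {A B : Type*}
    [NonUnitalNonAssocRing A] [Module K A] [SMulCommClass K A A] [IsScalarTower K A A]
    [NonUnitalNonAssocRing B] [Module K B] [SMulCommClass K B B] [IsScalarTower K B B]
    (𝒜 : G → Submodule K A) (ℬ : G → Submodule K B) (deg : ι → G) : Prop :=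
  ∀ R : FreeNonUnitalNonAssocAlgebra K (ι ⊕ ι),
    (∀ x y : ι → A, (∀ i, x i ∈ 𝒜 (deg i)) → (∀ i, y i ∈ 𝒜 (deg i)) → ev x y R = 0) →
    ∀ x y : ι → B, (∀ i, x i ∈ ℬ (deg i)) → (∀ i, y i ∈ ℬ (deg i)) → ev x y R = 0

theorem lift_lift_of {C : Type*} [NonUnitalNonAssocRing C] [Module K C] [SMulCommClass K C C]
    [IsScalarTower K C C] (e : ℕ × G → C) (enc : ι ⊕ ι → ℕ) (deg : ι → G)
    (R : FreeNonUnitalNonAssocAlgebra K (ι ⊕ ι)) :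
    FreeNonUnitalNonAssocAlgebra.lift K e (FreeNonUnitalNonAssocAlgebra.lift K
      (fun s => FreeNonUnitalNonAssocAlgebra.of K (enc s, Sum.elim deg deg s)) R) =
        ev (fun i => e (enc (.inl i), deg i)) (fun i => e (enc (.inr i), deg i)) R := by
  have : (FreeNonUnitalNonAssocAlgebra.lift K e).comp (FreeNonUnitalNonAssocAlgebra.lift K
      (fun s => FreeNonUnitalNonAssocAlgebra.of K (enc s, Sum.elim deg deg s))) =
      ev (fun i => e (enc (.inl i), deg i)) (fun i => e (enc (.inr i), deg i)) := by
    refine FreeNonUnitalNonAssocAlgebra.hom_ext K fun s => ?_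
    rcases s with i | i <;> simp [ev]
  exact DFunLike.congr_fun this R

theorem vanishingTransfers_of_gradedPI [Finite ι] {A B : Type*}
    [NonUnitalNonAssocRing A] [Module K A] [SMulCommClass K A A] [IsScalarTower K A A]
    [NonUnitalNonAssocRing B] [Module K B] [SMulCommClass K B B] [IsScalarTower K B B]
    {𝒜 : G → Submodule K A} {ℬ : G → Submodule K B}
    (h : ∀ f : FreeNonUnitalNonAssocAlgebra K (ℕ × G), IsGradedPI 𝒜 f → IsGradedPI ℬ f)
    (deg : ι → G) : VanishingTransfers 𝒜 ℬ deg := by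
  classical
  intro R hR x y hx hy
  obtain ⟨enc, henc⟩ := exists_injective_nat (ι ⊕ ι)
  let dg : ι ⊕ ι → G := Sum.elim deg deg
  let f := FreeNonUnitalNonAssocAlgebra.lift K
    (fun s => FreeNonUnitalNonAssocAlgebra.of K (enc s, Sum.elim deg deg s)) R
  have hf : IsGradedPI 𝒜 f := fun e he => by
    rw [lift_lift_of]
    exact hR _ _ (fun i => he _ _) (fun i => he _ _)
  let e : ℕ × G → B := fun p =>
    if hp : ∃ s, (enc s, dg s) = p then Sum.elim x y hp.choose else 0
  have he : ∀ s, e (enc s, dg s) = Sum.elim x y s := by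
    intro s
    have hp : ∃ s', (enc s', dg s') = (enc s, dg s) := ⟨s, rfl⟩
    have : hp.choose = s := henc (Prod.ext_iff.1 hp.choose_spec).1
    simp only [e, dif_pos hp, this]
  have hmem : ∀ n g, e (n, g) ∈ ℬ g := by
    intro n g
    by_cases hp : ∃ s, (enc s, dg s) = (n, g)
    · obtain ⟨s, hs⟩ := hp
      rw [← hs, he]
      obtain rfl : dg s = g := (Prod.ext_iff.1 hs).2
      rcases s with i | i
      · exact hx i
      · exact hy i
    · simp only [e, dif_neg hp, zero_mem]
  have := h f hf e hmem
  rw [lift_lift_of] at this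
  convert this using 4 with i i
  · exact (he (.inl i)).symm
  · exact (he (.inr i)).symm

section Ev

variable {C : Type*} [NonUnitalNonAssocRing C] [Module K C] [SMulCommClass K C C]
  [IsScalarTower K C C] (x y : ι → C)

@[simp]
theorem ev_varX (i : ι) : ev x y (varX K i) = x i := by simp [ev, varX]

@[simp]
theorem ev_varY (i : ι) : ev x y (varY K i) = y i := by simp [ev, varY]

variable (W : Words K ι)

theorem ev_mul (u v : FreeNonUnitalNonAssocAlgebra K (ι ⊕ ι)) :
    ev x y (W.mul (varY K) u v) = W.mul y (ev x y u) (ev x y v) := by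
  simp [W.map_mul]

variable [DecidableEq ι] [Fintype ι] [DecidableEq G] (deg : ι → G) (i₀ : ι)

theorem ev_alt : ev x y (W.alt deg i₀ (varY K) (varX K)) = W.alt deg i₀ y x := by
  simp [W.map_alt]

theorem ev_pow (d : ℕ) : ev x y (W.pow deg i₀ (varY K) (varX K) d) = W.pow deg i₀ y x d := by
  simp [W.map_pow]

theorem ev_alt_update (i j k : ι) :
    ev x y (W.alt deg i₀ (varY K) (Function.update (varX K) k (varX K i * varX K j))) =
      W.alt deg i₀ y (Function.update x k (x i * x j)) := by
  rw [W.map_alt]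
  congr 1
  · simp
  · ext l
    rcases eq_or_ne l k with rfl | h <;> simp [*]

end Ev

/-- `c` is a family of structure constants for `x`. -/
def IsStructure {C : Type*} [NonUnitalNonAssocRing C] [Module K C] [Fintype ι] (x : ι → C)
    (c : ι × ι × ι → K) : Prop :=
  ∀ i j, x i * x j = ∑ k, c (i, j, k) • x k

variable [DecidableEq ι] [Fintype ι] [Semigroup G] [DecidableEq G]

/-- `R` represents the polynomial function `p` of the structure constants,
multiplied by `W.pow d`. -/
def Represents {C : Type*} [NonUnitalNonAssocRing C] [Module K C] [SMulCommClass K C C]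
    [IsScalarTower K C C] (𝒞 : G → Submodule K C) (deg : ι → G) (W : Words K ι) (i₀ : ι)
    (R : FreeNonUnitalNonAssocAlgebra K (ι ⊕ ι)) (p : MvPolynomial (ι × ι × ι) K) (d : ℕ) : Prop :=
  ∀ x y : ι → C, (∀ i, x i ∈ 𝒞 (deg i)) →
    (¬ LinearIndependent K x → ev x y R = 0) ∧
    (LinearIndependent K x → ∀ c, IsStructure x c →
      ev x y R = MvPolynomial.eval c p • W.pow deg i₀ y x d)

section Represents

variable {C : Type*} [NonUnitalNonAssocRing C] [Module K C] [SMulCommClass K C C]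
    [IsScalarTower K C C] {𝒞 : G → Submodule K C} [DirectSum.Decomposition 𝒞]
    {deg : ι → G} {W : Words K ι} {i₀ : ι}
    {R R' : FreeNonUnitalNonAssocAlgebra K (ι ⊕ ι)} {p p' : MvPolynomial (ι × ι × ι) K} {d : ℕ}

omit [Semigroup G] in
theorem represents_C (r : K) :
    Represents 𝒞 deg W i₀ (r • W.alt deg i₀ (varY K) (varX K)) (MvPolynomial.C r) 0 := by
  intro x y hx
  refine ⟨fun h => ?_, fun _ c _ => ?_⟩
  · rw [map_smul, ev_alt, W.alt_eq_zero 𝒞 hx h, smul_zero]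
  · rw [map_smul, ev_alt, MvPolynomial.eval_C]
    rfl

omit [Semigroup G] [DirectSum.Decomposition 𝒞] in
theorem Represents.add (h : Represents 𝒞 deg W i₀ R p d) (h' : Represents 𝒞 deg W i₀ R' p' d) :
    Represents 𝒞 deg W i₀ (R + R') (p + p') d := by
  intro x y hx
  refine ⟨fun hli => ?_, fun hli c hc => ?_⟩
  · rw [map_add, (h x y hx).1 hli, (h' x y hx).1 hli, add_zero]
  · rw [map_add, (h x y hx).2 hli c hc, (h' x y hx).2 hli c hc, map_add, add_smul]

omit [Semigroup G] [DirectSum.Decomposition 𝒞] in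
theorem Represents.succ (h : Represents 𝒞 deg W i₀ R p d) :
    Represents 𝒞 deg W i₀ (W.mul (varY K) R (W.alt deg i₀ (varY K) (varX K))) p (d + 1) := by
  intro x y hx
  refine ⟨fun hli => ?_, fun hli c hc => ?_⟩
  · rw [ev_mul, (h x y hx).1 hli, W.zero_mul]
  · rw [ev_mul, (h x y hx).2 hli c hc, W.smul_mul, ev_alt]
    rfl

theorem Represents.mul_X (hgr : ∀ (g h : G), ∀ a ∈ 𝒞 g, ∀ b ∈ 𝒞 h, a * b ∈ 𝒞 (g * h))
    (h : Represents 𝒞 deg W i₀ R p d) (t : ι × ι × ι) :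
    Represents 𝒞 deg W i₀ (if deg t.1 * deg t.2.1 = deg t.2.2 then
      W.mul (varY K) R (W.alt deg i₀ (varY K)
        (Function.update (varX K) t.2.2 (varX K t.1 * varX K t.2.1))) else 0)
      (p * MvPolynomial.X t) (d + 1) := by
  obtain ⟨i, j, k⟩ := t
  intro x y hx
  refine ⟨fun hli => ?_, fun hli c hc => ?_⟩
  · split_ifs
    · rw [ev_mul, (h x y hx).1 hli, W.zero_mul]
    · exact map_zero _
  · have hmem := hgr _ _ _ (hx i) _ (hx j)
    rw [hc i j] at hmem
    split_ifs with hd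
    · dsimp only at hd ⊢
      rw [hd] at hmem
      rw [ev_mul, (h x y hx).2 hli c hc, W.smul_mul, ev_alt_update, hc i j,
        W.alt_update 𝒞 hx hmem, W.mul_smul, smul_smul, map_mul, MvPolynomial.eval_X]
      rfl
    · have : c (i, j, k) = 0 :=
        coeff_eq_zero 𝒞 hx hli (r := fun k => c (i, j, k)) hmem (fun h' => hd h'.symm)
      rw [map_zero, map_mul, MvPolynomial.eval_X, this, MulZeroClass.mul_zero, zero_smul]

end Represents

variable {A B : Type*}
  [NonUnitalNonAssocRing A] [Module K A] [SMulCommClass K A A] [IsScalarTower K A A]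
  [NonUnitalNonAssocRing B] [Module K B] [SMulCommClass K B B] [IsScalarTower K B B]
  {𝒜 : G → Submodule K A} {ℬ : G → Submodule K B}
  [DirectSum.Decomposition 𝒜] [DirectSum.Decomposition ℬ]

theorem exists_represents
    (hgrA : ∀ (g h : G), ∀ a ∈ 𝒜 g, ∀ b ∈ 𝒜 h, a * b ∈ 𝒜 (g * h))
    (hgrB : ∀ (g h : G), ∀ a ∈ ℬ g, ∀ b ∈ ℬ h, a * b ∈ ℬ (g * h))
    (deg : ι → G) (W : Words K ι) (i₀ : ι) (p : MvPolynomial (ι × ι × ι) K) :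
    ∃ d, ∀ e, d ≤ e → ∃ R, Represents 𝒜 deg W i₀ R p e ∧ Represents ℬ deg W i₀ R p e := by
  have mono : ∀ p d, (∃ R, Represents 𝒜 deg W i₀ R p d ∧ Represents ℬ deg W i₀ R p d) →
      ∀ e, d ≤ e → ∃ R, Represents 𝒜 deg W i₀ R p e ∧ Represents ℬ deg W i₀ R p e := by
    intro p d h e hde
    induction e, hde using Nat.le_induction with
    | base => exact h
    | succ e _ ih =>
      obtain ⟨R, h1, h2⟩ := ih
      exact ⟨_, h1.succ, h2.succ⟩
  induction p using MvPolynomial.induction_on with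
  | C r => exact ⟨0, mono _ _ ⟨_, represents_C r, represents_C r⟩⟩
  | add p q hp hq =>
    obtain ⟨d, hp⟩ := hp
    obtain ⟨d', hq⟩ := hq
    refine ⟨max d d', fun e he => ?_⟩
    obtain ⟨R, h1, h2⟩ := hp e (le_trans (le_max_left _ _) he)
    obtain ⟨R', h1', h2'⟩ := hq e (le_trans (le_max_right _ _) he)
    exact ⟨_, h1.add h1', h2.add h2'⟩
  | mul_X p t hp =>
    obtain ⟨d, hp⟩ := hp
    obtain ⟨R, h1, h2⟩ := hp d le_rfl
    exact ⟨d + 1, mono _ _ ⟨_, h1.mul_X hgrA t, h2.mul_X hgrB t⟩⟩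

variable {deg : ι → G} {W : Words K ι} {a : Module.Basis ι K A} {z : A}

omit [Semigroup G] [DirectSum.Decomposition 𝒜] in
theorem exists_pow_ne_zero (i₀ : ι) (H : VanishingTransfers ℬ 𝒜 deg)
    (ha : ∀ i, a i ∈ 𝒜 (deg i)) (hz0 : z ≠ 0) (hz : W.mul a z z = z)
    (hleaf : ∀ i j, deg i = deg j → mulAct K a (W.leaf i) (a j) = if i = j then z else 0) (d : ℕ) :
    ∃ x y : ι → B, (∀ i, x i ∈ ℬ (deg i)) ∧ (∀ i, y i ∈ ℬ (deg i)) ∧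
      LinearIndependent K x ∧ W.pow deg i₀ y x d ≠ 0 := by
  by_contra! hc
  have := H (W.pow deg i₀ (varY K) (varX K) d) (fun x y hx hy => ?_) a a ha ha
  · rw [ev_pow, W.pow_eq deg hz hleaf] at this
    exact hz0 this
  · rw [ev_pow]
    by_cases hli : LinearIndependent K x
    · exact hc x y hx hy hli
    · exact W.pow_eq_zero deg i₀ y x (W.alt_eq_zero ℬ hx hli) d

theorem eval_eq_zero_of_vanishingTransfers
    (hgrA : ∀ (g h : G), ∀ a ∈ 𝒜 g, ∀ b ∈ 𝒜 h, a * b ∈ 𝒜 (g * h))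
    (hgrB : ∀ (g h : G), ∀ a ∈ ℬ g, ∀ b ∈ ℬ h, a * b ∈ ℬ (g * h))
    (H : VanishingTransfers 𝒜 ℬ deg) (H' : VanishingTransfers ℬ 𝒜 deg)
    (ha : ∀ i, a i ∈ 𝒜 (deg i)) (hz0 : z ≠ 0) (hz : W.mul a z z = z)
    (hleaf : ∀ i j, deg i = deg j → mulAct K a (W.leaf i) (a j) = if i = j then z else 0)
    (hfin : Fintype.card ι = Module.finrank K B) (p : MvPolynomial (ι × ι × ι) K)
    (hp : ∀ x : Module.Basis ι K A, (∀ i, x i ∈ 𝒜 (deg i)) → ∀ c, IsStructure x c →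
      MvPolynomial.eval c p = 0)
    (x : Module.Basis ι K B) (hx : ∀ i, x i ∈ ℬ (deg i)) (c : ι × ι × ι → K)
    (hc : IsStructure x c) : MvPolynomial.eval c p = 0 := by
  have hA : Nontrivial A := ⟨z, 0, hz0⟩
  have hι : Nonempty ι := a.index_nonempty
  let i₀ := hι.some
  have hfinA : Fintype.card ι = Module.finrank K A := (Module.finrank_eq_card_basis a).symm
  obtain ⟨d, hd⟩ := exists_represents hgrA hgrB deg W i₀ p
  obtain ⟨R, hRA, hRB⟩ := hd d le_rfl
  obtain ⟨x₁, y, hx₁, hy, hli, hne⟩ := exists_pow_ne_zero i₀ H' ha hz0 hz hleaf d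
  have hR := H R (fun x y hx _ => ?_) x y hx hy
  · rw [(hRB x y hx).2 x.linearIndependent c hc] at hR
    refine (smul_eq_zero.1 hR).resolve_right fun h0 => hne ?_
    let b₁ := basisOfLinearIndependentOfCardEqFinrank hli hfin
    have hb₁ : ⇑b₁ = x₁ := coe_basisOfLinearIndependentOfCardEqFinrank hli hfin
    obtain ⟨r, hr, h⟩ := W.exists_alt_eq_smul ℬ (i₀ := i₀) (y := y) x b₁ hx
      (fun i => by rw [hb₁]; exact hx₁ i)
    obtain ⟨s, -, hs⟩ := W.exists_pow_eq_smul deg i₀ y x b₁ hr h d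
    rw [← hb₁, hs, h0, smul_zero]
  · by_cases hli : LinearIndependent K x
    · let b := basisOfLinearIndependentOfCardEqFinrank hli hfinA
      have hb : ⇑b = x := coe_basisOfLinearIndependentOfCardEqFinrank hli hfinA
      let c' : ι × ι × ι → K := fun t => b.repr (b t.1 * b t.2.1) t.2.2
      have hc' : IsStructure b c' := fun i j => (b.sum_repr (b i * b j)).symm
      have h0 := hp b (fun i => by rw [hb]; exact hx i) c' hc'
      rw [(hRA x y hx).2 hli c' (hb ▸ hc'), h0, zero_smul]
    · exact (hRA x y hx).1 hli

end Transfer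

section GradedMultiplication

variable (K : Type*) {G A : Type*} [Field K] [DecidableEq G]
  [NonUnitalNonAssocRing A] [Module K A] [SMulCommClass K A A] [IsScalarTower K A A]
  (𝒜 : G → Submodule K A) [DirectSum.Decomposition 𝒜]

/-- The algebra of operators on `A` generated by left multiplications, right multiplications,
and projections to the homogeneous components. -/
noncomputable def gradedMulAlgebra : Subalgebra K (Module.End K A) :=
  Algebra.adjoin K (Set.range (LinearMap.mulLeft K) ∪ Set.range (LinearMap.mulRight K) ∪
    Set.range (proj 𝒜))

theorem mulLeft_mem (b : A) : LinearMap.mulLeft K b ∈ gradedMulAlgebra K 𝒜 :=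
  Algebra.subset_adjoin (.inl (.inl ⟨b, rfl⟩))

theorem mulRight_mem (b : A) : LinearMap.mulRight K b ∈ gradedMulAlgebra K 𝒜 :=
  Algebra.subset_adjoin (.inl (.inr ⟨b, rfl⟩))

theorem proj_mem_gradedMulAlgebra (g : G) : proj 𝒜 g ∈ gradedMulAlgebra K 𝒜 :=
  Algebra.subset_adjoin (.inr ⟨g, rfl⟩)

variable {K 𝒜}

theorem proj_mem_submodule (N : Submodule (gradedMulAlgebra K 𝒜) A) {c : A} (hc : c ∈ N) (g : G) :
    proj 𝒜 g c ∈ N :=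
  N.smul_mem ⟨_, proj_mem_gradedMulAlgebra K 𝒜 g⟩ hc

theorem isGradedIdeal_restrictScalars (N : Submodule (gradedMulAlgebra K 𝒜) A) :
    IsGradedIdeal 𝒜 (N.restrictScalars K) := by
  refine ⟨fun a ha b => ⟨?_, ?_⟩, le_antisymm (fun c hc => ?_) ?_⟩
  · exact N.smul_mem ⟨_, mulRight_mem K 𝒜 b⟩ ha
  · exact N.smul_mem ⟨_, mulLeft_mem K 𝒜 b⟩ ha
  · classical
    rw [← DirectSum.sum_support_decompose 𝒜 c]
    exact sum_mem fun g _ => Submodule.mem_iSup_of_mem g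
      ⟨proj_mem_submodule N hc g, proj_mem 𝒜 g c⟩
  · exact iSup_le fun g => inf_le_left

variable {ι : Type*} [Fintype ι] {deg : ι → G} {a : Module.Basis ι K A}

theorem exists_mulAct_eq_proj [Semigroup G]
    (hgr : ∀ (g h : G), ∀ a ∈ 𝒜 g, ∀ b ∈ 𝒜 h, a * b ∈ 𝒜 (g * h))
    (ha : ∀ i, a i ∈ 𝒜 (deg i)) {m : Module.End K A} (hm : m ∈ gradedMulAlgebra K 𝒜) (g h : G) :
    ∃ ω : FreeAlgebra K (ι ⊕ ι), ∀ x ∈ 𝒜 g, mulAct K a ω x = proj 𝒜 h (m x) := by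
  induction hm using Algebra.adjoin_induction generalizing g h with
  | mem m hm =>
    rcases hm with (⟨b, rfl⟩ | ⟨b, rfl⟩) | ⟨k, rfl⟩
    · refine ⟨∑ i, if deg i * g = h then a.repr b i • FreeAlgebra.ι K (.inl i) else 0,
        fun x hx => ?_⟩
      conv_rhs => rw [← a.sum_repr b]
      simp only [map_sum, LinearMap.sum_apply, LinearMap.mulLeft_apply, Finset.sum_mul]
      refine Finset.sum_congr rfl fun i _ => ?_
      rw [smul_mul_assoc, map_smul, proj_of_mem_eq_ite 𝒜 h (hgr _ _ _ (ha i) _ hx)]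
      split_ifs <;> simp [mulAct]
    · refine ⟨∑ i, if g * deg i = h then a.repr b i • FreeAlgebra.ι K (.inr i) else 0,
        fun x hx => ?_⟩
      conv_rhs => rw [← a.sum_repr b]
      simp only [map_sum, LinearMap.sum_apply, LinearMap.mulRight_apply, Finset.mul_sum]
      refine Finset.sum_congr rfl fun i _ => ?_
      rw [mul_smul_comm, map_smul, proj_of_mem_eq_ite 𝒜 h (hgr _ _ _ hx _ (ha i))]
      split_ifs <;> simp [mulAct]
    · refine ⟨if g = k ∧ g = h then 1 else 0, fun x hx => ?_⟩
      rw [proj_of_mem_eq_ite 𝒜 k hx]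
      by_cases hk : g = k
      · by_cases hh : g = h
        · simp [hk, ← hh, proj_of_mem 𝒜 (hk ▸ hx)]
        · simp [hk ▸ hh, hk, proj_of_mem_ne 𝒜 hx hh]
      · simp [hk]
  | algebraMap r =>
    refine ⟨if g = h then algebraMap _ _ r else 0, fun x hx => ?_⟩
    rw [Module.algebraMap_end_apply, map_smul, proj_of_mem_eq_ite 𝒜 h hx]
    split_ifs <;> simp
  | add m m' _ _ ih ih' =>
    obtain ⟨ω, hω⟩ := ih g h
    obtain ⟨ω', hω'⟩ := ih' g h
    exact ⟨ω + ω', fun x hx => by simp [hω x hx, hω' x hx]⟩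
  | mul m m' _ _ ih ih' =>
    choose ω hω using fun k => ih k h
    choose ω' hω' using ih' g
    refine ⟨∑ k ∈ Finset.univ.image deg, ω k * ω' k, fun x hx => ?_⟩
    rw [Module.End.mul_apply]
    conv_rhs => rw [← sum_proj 𝒜 ha (m' x)]
    simp only [map_sum, LinearMap.sum_apply]
    refine Finset.sum_congr rfl fun k _ => ?_
    rw [map_mul, Module.End.mul_apply, hω' k x hx, hω k _ (proj_mem 𝒜 k _)]

theorem exists_smul_eq_apply [IsAlgClosed K] [FiniteDimensional K A]
    (I : Submodule (gradedMulAlgebra K 𝒜) A) [IsSimpleModule (gradedMulAlgebra K 𝒜) I]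
    (f : I →ₗ[K] I) (s : Finset I) : ∃ m : gradedMulAlgebra K 𝒜, ∀ v ∈ s, f v = m • v := by
  have : FiniteDimensional K I :=
    inferInstanceAs (FiniteDimensional K (I.restrictScalars K))
  let f' : Module.End (Module.End (gradedMulAlgebra K 𝒜) I) I :=
    { toFun := f
      map_add' := map_add f
      map_smul' := fun e v => by
        obtain ⟨r, rfl⟩ :=
          (IsSimpleModule.algebraMap_end_bijective_of_isAlgClosed K (A := gradedMulAlgebra K 𝒜)
            (V := I)).2 e
        simp }
  exact jacobson_density f' s

/-- In a graded-prime algebra, every functional times an element of a minimal graded ideal is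
given by an element of the graded multiplication algebra. -/
theorem exists_apply_basis_eq_smul [IsAlgClosed K] [FiniteDimensional K A] (hA : IsGradedPrime 𝒜)
    (a : Module.Basis ι K A)
    (I : Submodule (gradedMulAlgebra K 𝒜) A) [IsSimpleModule (gradedMulAlgebra K 𝒜) I]
    (l : Module.Dual K A) {z : A} (hz : z ∈ I) :
    ∃ m ∈ gradedMulAlgebra K 𝒜, ∀ j, m (a j) = l (a j) • z := by
  classical
  let Λ : Submodule K (Module.Dual K A) :=
    { carrier := {l | ∀ z ∈ I, ∃ m ∈ gradedMulAlgebra K 𝒜, ∀ j, m (a j) = l (a j) • z}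
      add_mem' := fun {l l'} h h' z hz => by
        obtain ⟨m, hm, e⟩ := h z hz
        obtain ⟨m', hm', e'⟩ := h' z hz
        exact ⟨m + m', add_mem hm hm', fun j => by simp [e, e', add_smul]⟩
      zero_mem' := fun z _ => ⟨0, zero_mem _, fun j => by simp⟩
      smul_mem' := fun r l h z hz => by
        obtain ⟨m, hm, e⟩ := h z hz
        exact ⟨r • m, Subalgebra.smul_mem _ hm r, fun j => by simp [e, smul_smul]⟩ }
  suffices h : Λ = ⊤ from (h ▸ Submodule.mem_top : l ∈ Λ) z hz
  let N : Submodule (gradedMulAlgebra K 𝒜) A :=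
    { carrier := {c | ∀ m ∈ gradedMulAlgebra K 𝒜, (∀ x, m x ∈ I) → m c = 0}
      add_mem' := fun h h' m hm hI => by rw [map_add, h m hm hI, h' m hm hI, add_zero]
      zero_mem' := fun m _ _ => map_zero m
      smul_mem' := fun n c h m hm hI => h (m * n) (mul_mem hm n.2) fun x => hI _ }
  have hI0 : I.restrictScalars K ≠ ⊥ := by
    intro h
    have := IsSimpleModule.nontrivial (gradedMulAlgebra K 𝒜) I
    obtain ⟨x, hx⟩ := exists_ne (0 : I)
    have hx' : (x : A) ∈ I.restrictScalars K := x.2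
    rw [h, Submodule.mem_bot] at hx'
    exact hx (Subtype.ext hx')
  have hN : N.restrictScalars K = ⊥ :=
    (hA _ _ (isGradedIdeal_restrictScalars I) (isGradedIdeal_restrictScalars N)
      fun z hz c hc => hc _ (mulLeft_mem K 𝒜 z) fun x =>
        ((isGradedIdeal_restrictScalars I).1 z hz x).1).resolve_left hI0
  rw [← Subspace.dualCoannihilator_dualAnnihilator_eq (W := Λ)]
  suffices h : Λ.dualCoannihilator = ⊥ by rw [h, Submodule.dualAnnihilator_bot]
  rw [eq_bot_iff]
  intro c hc
  rw [← hN]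
  intro w hw hwI
  rw [Submodule.mem_dualCoannihilator] at hc
  let w' : A →ₗ[K] I.restrictScalars K := w.codRestrict (I.restrictScalars K) hwI
  suffices h : w' c = 0 from congrArg Subtype.val h
  rw [← Module.forall_dual_apply_eq_zero_iff K]
  intro ξ
  refine hc (ξ ∘ₗ w') fun z hz => ?_
  obtain ⟨m, hm⟩ := exists_smul_eq_apply I (ξ.smulRight ⟨z, hz⟩ : I →ₗ[K] I)
    (Finset.univ.image fun j => w' (a j))
  refine ⟨m * w, mul_mem m.2 hw, fun j => ?_⟩
  exact (congrArg Subtype.val (hm (w' (a j)) (Finset.mem_image_of_mem _ (Finset.mem_univ j)))).symm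

theorem exists_mem_gradedMulAlgebra_apply_eq (I : Submodule (gradedMulAlgebra K 𝒜) A)
    [IsSimpleModule (gradedMulAlgebra K 𝒜) I] {u v : A} (hu : u ∈ I) (hv : v ∈ I) (hu0 : u ≠ 0) :
    ∃ m ∈ gradedMulAlgebra K 𝒜, m u = v := by
  have h := IsSimpleModule.toSpanSingleton_surjective (gradedMulAlgebra K 𝒜)
    (m := (⟨u, hu⟩ : I)) (by simpa using hu0)
  obtain ⟨m, hm⟩ := h ⟨v, hv⟩
  exact ⟨m, m.2, congrArg Subtype.val hm⟩

theorem exists_words [IsAlgClosed K] [FiniteDimensional K A] [Nontrivial A] [Semigroup G]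
    [DecidableEq ι] (hgr : ∀ (g h : G), ∀ a ∈ 𝒜 g, ∀ b ∈ 𝒜 h, a * b ∈ 𝒜 (g * h))
    (hA : IsGradedPrime 𝒜) (ha : ∀ i, a i ∈ 𝒜 (deg i)) :
    ∃ (W : Words K ι) (z : A), z ≠ 0 ∧ W.mul a z z = z ∧
      ∀ i j, deg i = deg j → mulAct K a (W.leaf i) (a j) = if i = j then z else 0 := by
  have : IsArtinian (gradedMulAlgebra K 𝒜) A := isArtinian_of_tower K inferInstance
  obtain ⟨I, hI, -⟩ :=
    (eq_bot_or_exists_atom_le (⊤ : Submodule (gradedMulAlgebra K 𝒜) A)).resolve_left top_ne_bot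
  have hsimple : IsSimpleModule (gradedMulAlgebra K 𝒜) I := isSimpleModule_iff_isAtom.2 hI
  obtain ⟨c, hcI, hc0⟩ := I.exists_mem_ne_zero_of_ne_bot hI.1
  obtain ⟨h, hz0⟩ := exists_proj_ne_zero 𝒜 hc0
  have hzI := proj_mem_submodule I hcI h
  have hz := proj_mem 𝒜 h c
  generalize proj 𝒜 h c = z at *
  obtain ⟨g, k, u, v, hu, hv, huI, hvI, huv⟩ : ∃ g k u v, u ∈ 𝒜 g ∧ v ∈ 𝒜 k ∧ u ∈ I ∧ v ∈ I ∧
      u * v ≠ 0 := by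
    by_contra! hc
    have hp := hA _ _ (isGradedIdeal_restrictScalars I) (isGradedIdeal_restrictScalars I)
      fun p hp q hq => by
        rw [← sum_proj 𝒜 ha p, ← sum_proj 𝒜 ha q, Finset.sum_mul]
        refine Finset.sum_eq_zero fun g _ => ?_
        rw [Finset.mul_sum]
        exact Finset.sum_eq_zero fun k _ => hc g k _ _ (proj_mem 𝒜 _ _) (proj_mem 𝒜 _ _)
          (proj_mem_submodule I hp g) (proj_mem_submodule I hq k)
    rw [or_self] at hp
    have hz' : z ∈ I.restrictScalars K := hzI
    rw [hp, Submodule.mem_bot] at hz'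
    exact hz0 hz'
  have huvI : u * v ∈ I := ((isGradedIdeal_restrictScalars I).1 u huI v).1
  have hword : ∀ {g h : G} {u v : A}, u ∈ 𝒜 g → v ∈ 𝒜 h → u ∈ I → v ∈ I → u ≠ 0 →
      ∃ ω : FreeAlgebra K (ι ⊕ ι), mulAct K a ω u = v := by
    intro g h u v hu hv huI hvI hu0
    obtain ⟨m, hm, rfl⟩ := exists_mem_gradedMulAlgebra_apply_eq I huI hvI hu0
    obtain ⟨ω, hω⟩ := exists_mulAct_eq_proj hgr ha hm g h
    exact ⟨ω, by rw [hω u hu, proj_of_mem 𝒜 hv]⟩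
  obtain ⟨left, hleft⟩ := hword hz hu hzI huI hz0
  obtain ⟨right, hright⟩ := hword hz hv hzI hvI hz0
  obtain ⟨out, hout⟩ := hword (hgr _ _ _ hu _ hv) hz huvI hzI huv
  have hleaf : ∀ i, ∃ ω : FreeAlgebra K (ι ⊕ ι), ∀ j, deg i = deg j →
      mulAct K a ω (a j) = if i = j then z else 0 := by
    intro i
    obtain ⟨m, hm, e⟩ := exists_apply_basis_eq_smul hA a I (a.coord i) hzI
    obtain ⟨ω, hω⟩ := exists_mulAct_eq_proj hgr ha hm (deg i) h
    refine ⟨ω, fun j hj => ?_⟩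
    rw [hω _ (hj ▸ ha j), e, map_smul, proj_of_mem 𝒜 hz, Module.Basis.coord_apply,
      Module.Basis.repr_self, Finsupp.single_apply]
    rcases eq_or_ne i j with rfl | hij
    · simp
    · simp [hij, hij.symm]
  choose leaf hleaf using hleaf
  refine ⟨⟨out, left, right, leaf⟩, z, hz0, ?_, hleaf⟩
  rw [Words.mul, hleft, hright, hout]

end GradedMultiplication

section Points

variable {K : Type*} [Field K] [IsAlgClosed K]

variable (K) in
theorem nonempty_algHom_of_finiteType (R : Type*) [CommRing R] [Nontrivial R] [Algebra K R]
    [Algebra.FiniteType K R] : Nonempty (R →ₐ[K] K) := by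
  obtain ⟨m, hm⟩ := Ideal.exists_maximal R
  let _ : Field (R ⧸ m) := Ideal.Quotient.field m
  have : Algebra.FiniteType K (R ⧸ m) :=
    Algebra.FiniteType.of_surjective (Ideal.Quotient.mkₐ K m) (Ideal.Quotient.mkₐ_surjective K m)
  have : Module.Finite K (R ⧸ m) := finite_of_finite_type_of_isJacobsonRing K (R ⧸ m)
  have h : Function.Bijective (algebraMap K (R ⧸ m)) :=
    IsAlgClosed.algebraMap_bijective_of_isIntegral
  let e : K ≃ₐ[K] R ⧸ m := AlgEquiv.ofBijective (Algebra.ofId K (R ⧸ m)) h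
  exact ⟨e.symm.toAlgHom.comp (Ideal.Quotient.mkₐ K m)⟩

variable (K) in
theorem exists_algHom_ne_zero {R : Type*} [CommRing R] [IsDomain R] [Algebra K R]
    [Algebra.FiniteType K R] {r : R} (hr : r ≠ 0) : ∃ α : R →ₐ[K] K, α r ≠ 0 := by
  have : IsDomain (Localization.Away r) :=
    IsLocalization.isDomain_localization (powers_le_nonZeroDivisors_of_noZeroDivisors hr)
  have : Algebra.FiniteType R (Localization.Away r) :=
    IsLocalization.finiteType_of_monoid_fg (Submonoid.powers r) _
  have : Algebra.FiniteType K (Localization.Away r) :=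
    Algebra.FiniteType.trans (S := R) inferInstance inferInstance
  obtain ⟨α⟩ := nonempty_algHom_of_finiteType K (Localization.Away r)
  refine ⟨α.comp (IsScalarTower.toAlgHom K R _), ?_⟩
  exact ((IsLocalization.Away.algebraMap_isUnit r).map α).ne_zero

/-- Two algebra maps from `Q` to domains of finite type with the same kernel
have a common point. -/
theorem exists_comp_eq_comp {Q R S : Type*} [CommRing Q] [CommRing R] [CommRing S]
    [Algebra K Q] [Algebra K R] [Algebra K S] [IsDomain R] [IsDomain S]
    [Algebra.FiniteType K R] [Algebra.FiniteType K S] (φ : Q →ₐ[K] R) (ψ : Q →ₐ[K] S)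
    (h : ∀ q, φ q = 0 ↔ ψ q = 0) :
    ∃ (α : R →ₐ[K] K) (β : S →ₐ[K] K), ∀ q, α (φ q) = β (ψ q) := by
  let I := RingHom.ker φ
  let φ' : Q ⧸ I →ₐ[K] R := Ideal.Quotient.liftₐ I φ fun q hq => hq
  let ψ' : Q ⧸ I →ₐ[K] S := Ideal.Quotient.liftₐ I ψ fun q hq => (h q).1 hq
  let _ : Algebra (Q ⧸ I) R := φ'.toRingHom.toAlgebra
  let _ : Algebra (Q ⧸ I) S := ψ'.toRingHom.toAlgebra
  have : IsScalarTower K (Q ⧸ I) R := .of_algebraMap_eq fun r => (φ'.commutes r).symm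
  have : IsScalarTower K (Q ⧸ I) S := .of_algebraMap_eq fun r => (ψ'.commutes r).symm
  have hφ : Function.Injective (algebraMap (Q ⧸ I) R) := by
    refine (injective_iff_map_eq_zero _).2 fun q hq => ?_
    obtain ⟨q, rfl⟩ := Ideal.Quotient.mk_surjective q
    exact Ideal.Quotient.eq_zero_iff_mem.2 hq
  have hψ : Function.Injective (algebraMap (Q ⧸ I) S) := by
    refine (injective_iff_map_eq_zero _).2 fun q hq => ?_
    obtain ⟨q, rfl⟩ := Ideal.Quotient.mk_surjective q
    exact Ideal.Quotient.eq_zero_iff_mem.2 ((h q).2 hq)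
  have := Algebra.TensorProduct.nontrivial_of_algebraMap_injective_of_isDomain (Q ⧸ I) R S hφ hψ
  have : Algebra.FiniteType (Q ⧸ I) S := .of_restrictScalars_finiteType K _ _
  have : Algebra.FiniteType K (TensorProduct (Q ⧸ I) R S) :=
    Algebra.FiniteType.trans (S := R) inferInstance inferInstance
  obtain ⟨χ⟩ := nonempty_algHom_of_finiteType K (TensorProduct (Q ⧸ I) R S)
  refine ⟨χ.comp (Algebra.TensorProduct.includeLeft (R := Q ⧸ I)),
    χ.comp ((Algebra.TensorProduct.includeRight (R := Q ⧸ I)).restrictScalars K), fun q => ?_⟩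
  have h1 : algebraMap (Q ⧸ I) R (Ideal.Quotient.mk I q) = φ q := rfl
  have h2 : algebraMap (Q ⧸ I) S (Ideal.Quotient.mk I q) = ψ q := rfl
  rw [← h1, ← h2]
  simp only [AlgHom.comp_apply, AlgHom.restrictScalars_apply, AlgHom.commutes]
  exact congrArg χ (AlgHom.commutes
    (Algebra.TensorProduct.includeLeft (R := Q ⧸ I) (S := Q ⧸ I) (A := R) (B := S)) _)

end Points

section Generic

variable {K ι G : Type*} [Field K] [Fintype ι] [DecidableEq ι]

/-- The transformation of structure constants under a change of basis `t` with inverse `s`. -/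
def transform {R : Type*} [CommRing R] [Algebra K R] (c : ι × ι × ι → K) (t s : Matrix ι ι R)
    (p : ι × ι × ι) : R :=
  ∑ l, ∑ m, ∑ n, t p.1 l * t p.2.1 m * algebraMap K R (c (l, m, n)) * s n p.2.2

omit [DecidableEq ι] in
theorem map_transform {R : Type*} [CommRing R] [Algebra K R] (α : R →ₐ[K] K) (c : ι × ι × ι → K)
    (t s : Matrix ι ι R) (p : ι × ι × ι) :
    α (transform c t s p) = transform c (t.map α) (s.map α) p := by
  simp [transform]

variable {C : Type*} [NonUnitalNonAssocRing C] [Module K C] [SMulCommClass K C C]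
  [IsScalarTower K C C]

omit [SMulCommClass K C C] [IsScalarTower K C C] in
theorem eq_sum_of_mul_eq_one (a : ι → C) {t s : Matrix ι ι K} (h : s * t = 1) (n : ι) :
    ∑ k, s n k • ∑ l, t k l • a l = a n := by
  simp only [Finset.smul_sum, smul_smul]
  rw [Finset.sum_comm]
  simp only [← Finset.sum_smul, ← Matrix.mul_apply, h, Matrix.one_apply]
  simp

theorem isStructure_transform {a : ι → C} {c : ι × ι × ι → K} (hc : IsStructure a c)
    {t s : Matrix ι ι K} (h : s * t = 1) :
    IsStructure (fun i => ∑ l, t i l • a l) (transform c t s) := by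
  intro i j
  have key : ∀ l m, (t i l • a l) * (t j m • a m) =
      ∑ k, ∑ n, (t i l * t j m * c (l, m, n) * s n k) • ∑ l, t k l • a l := by
    intro l m
    rw [smul_mul_smul_comm, hc l m, Finset.sum_comm, Finset.smul_sum]
    refine Finset.sum_congr rfl fun n _ => ?_
    conv_lhs => rw [← eq_sum_of_mul_eq_one a h n, smul_smul, Finset.smul_sum]
    simp only [smul_smul]
  simp only [transform, Algebra.algebraMap_self, RingHom.id_apply, Finset.sum_smul]
  rw [Finset.sum_mul, Finset.sum_comm]
  refine Finset.sum_congr rfl fun l _ => ?_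
  rw [Finset.mul_sum, Finset.sum_comm]
  exact Finset.sum_congr rfl fun m _ => key l m

variable (K) in
/-- The generic degree-preserving matrix. -/
noncomputable def genericMatrix [DecidableEq G] (deg : ι → G) :
    Matrix ι ι (MvPolynomial (ι × ι) K) :=
  fun i j => if deg i = deg j then MvPolynomial.X (i, j) else 0

variable [DecidableEq G] (deg : ι → G)

theorem det_genericMatrix_ne_zero : (genericMatrix K deg).det ≠ 0 := by
  intro h
  let ε : MvPolynomial (ι × ι) K →ₐ[K] K :=
    MvPolynomial.aeval fun p => if p.1 = p.2 then 1 else 0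
  have := congrArg ε h
  rw [AlgHom.map_det, map_zero] at this
  have h1 : ε.mapMatrix (genericMatrix K deg) = 1 := by
    ext i j
    rcases eq_or_ne i j with rfl | hij
    · simp [genericMatrix, ε]
    · simp [genericMatrix, hij, apply_ite, ε]
  rw [h1, Matrix.det_one] at this
  exact one_ne_zero this

variable (K) in
/-- The coordinate ring of the group of degree-preserving invertible matrices. -/
abbrev GenericRing : Type _ := Localization.Away (genericMatrix K deg).det

instance : IsDomain (GenericRing K deg) :=
  IsLocalization.isDomain_localization
    (powers_le_nonZeroDivisors_of_noZeroDivisors (det_genericMatrix_ne_zero deg))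

instance : Algebra.FiniteType K (GenericRing K deg) :=
  have : Algebra.FiniteType (MvPolynomial (ι × ι) K) (GenericRing K deg) :=
    IsLocalization.finiteType_of_monoid_fg (Submonoid.powers (genericMatrix K deg).det) _
  Algebra.FiniteType.trans (S := MvPolynomial (ι × ι) K) inferInstance inferInstance

variable (K) in
/-- The generic degree-preserving matrix over `GenericRing`, where it is invertible. -/
noncomputable def genericUnit : Matrix ι ι (GenericRing K deg) :=
  (genericMatrix K deg).map (algebraMap _ _)

theorem isUnit_det_genericUnit : IsUnit (genericUnit K deg).det := by
  have := IsLocalization.Away.algebraMap_isUnit (S := GenericRing K deg) (genericMatrix K deg).det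
  rwa [RingHom.map_det] at this

variable {deg}

theorem map_genericUnit_mul (α : GenericRing K deg →ₐ[K] K) :
    ((genericUnit K deg)⁻¹.map α) * ((genericUnit K deg).map α) = 1 := by
  rw [← Matrix.map_mul, Matrix.nonsing_inv_mul _ (isUnit_det_genericUnit deg)]
  exact Matrix.map_one _ (map_zero α) (map_one α)

theorem genericUnit_apply_of_ne (i j : ι) (h : deg i ≠ deg j) : genericUnit K deg i j = 0 := by
  simp [genericUnit, genericMatrix, h]

variable {𝒞 : G → Submodule K C} [DirectSum.Decomposition 𝒞]

omit [DirectSum.Decomposition 𝒞] in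
/-- A point of `GenericRing` gives a homogeneous basis. -/
theorem exists_basis_of_algHom (a : Module.Basis ι K C) (ha : ∀ i, a i ∈ 𝒞 (deg i))
    {c : ι × ι × ι → K} (hc : IsStructure a c) (α : GenericRing K deg →ₐ[K] K) :
    ∃ x : Module.Basis ι K C, (∀ i, x i ∈ 𝒞 (deg i)) ∧
      IsStructure x (fun p => α (transform c (genericUnit K deg) (genericUnit K deg)⁻¹ p)) := by
  have hst := map_genericUnit_mul α
  have hspan : ⊤ ≤ Submodule.span K
      (Set.range fun i => ∑ l, (genericUnit K deg).map α i l • a l) := by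
    rw [← a.span_eq, Submodule.span_le]
    rintro _ ⟨n, rfl⟩
    rw [← eq_sum_of_mul_eq_one a hst n]
    exact sum_mem fun k _ => Submodule.smul_mem _ _ (Submodule.subset_span ⟨k, rfl⟩)
  refine ⟨basisOfTopLeSpanOfCardEqFinrank _ hspan (Module.finrank_eq_card_basis a).symm, ?_, ?_⟩
  · intro i
    rw [coe_basisOfTopLeSpanOfCardEqFinrank]
    refine sum_mem fun l _ => ?_
    by_cases h : deg i = deg l
    · exact Submodule.smul_mem _ _ (h ▸ ha l)
    · simp [genericUnit_apply_of_ne i l h]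
  · rw [coe_basisOfTopLeSpanOfCardEqFinrank]
    simp only [map_transform]
    exact isStructure_transform hc hst

/-- A homogeneous basis gives a point of `GenericRing`. -/
theorem exists_algHom_of_basis (a : Module.Basis ι K C) (ha : ∀ i, a i ∈ 𝒞 (deg i))
    {c : ι × ι × ι → K} (hc : IsStructure a c) (x : Module.Basis ι K C)
    (hx : ∀ i, x i ∈ 𝒞 (deg i)) {c' : ι × ι × ι → K} (hc' : IsStructure x c') :
    ∃ α : GenericRing K deg →ₐ[K] K,
      ∀ p, α (transform c (genericUnit K deg) (genericUnit K deg)⁻¹ p) = c' p := by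
  let ε : MvPolynomial (ι × ι) K →ₐ[K] K := MvPolynomial.aeval fun p => a.repr (x p.1) p.2
  have hε : ε.mapMatrix (genericMatrix K deg) = (a.toMatrix x).transpose := by
    ext i j
    simp only [AlgHom.mapMatrix_apply, Matrix.map_apply, genericMatrix, Matrix.transpose_apply,
      Module.Basis.toMatrix_apply]
    split_ifs with h
    · simp [ε]
    · rw [map_zero]
      refine (coeff_eq_zero 𝒞 ha a.linearIndependent (g := deg i) (r := fun j => a.repr (x i) j)
        ?_ (Ne.symm h)).symm
      rw [a.sum_repr]
      exact hx i
  have hunit : IsUnit (ε (genericMatrix K deg).det) := by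
    rw [AlgHom.map_det, hε, Matrix.det_transpose]
    exact a.isUnit_det x
  let α : GenericRing K deg →ₐ[K] K := IsLocalization.liftAlgHom
    (M := Submonoid.powers (genericMatrix K deg).det) (f := ε) (by
      rintro ⟨_, n, rfl⟩
      simpa using hunit.pow n)
  have hα : (genericUnit K deg).map α = (a.toMatrix x).transpose := by
    rw [← hε]
    ext i j
    simp [genericUnit, α]
  have hst := map_genericUnit_mul α
  have hx' : (fun i => ∑ l, (genericUnit K deg).map α i l • a l) = x := by
    ext i
    rw [hα]
    exact a.sum_repr (x i)
  have := isStructure_transform hc hst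
  rw [hx'] at this
  refine ⟨α, fun ⟨i, j, k⟩ => ?_⟩
  rw [map_transform]
  have h := (this i j).symm.trans (hc' i j)
  rw [← sub_eq_zero, ← Finset.sum_sub_distrib] at h
  simp only [← sub_smul] at h
  exact sub_eq_zero.1 (Fintype.linearIndependent_iff.1 x.linearIndependent _ h k)

end Generic

section Main

variable {K G A B : Type*} [Field K]
  [NonUnitalNonAssocRing A] [Module K A] [SMulCommClass K A A] [IsScalarTower K A A]
  [NonUnitalNonAssocRing B] [Module K B] [SMulCommClass K B B] [IsScalarTower K B B]
  {𝒜 : G → Submodule K A} {ℬ : G → Submodule K B}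

omit [SMulCommClass K A A] [IsScalarTower K A A] [SMulCommClass K B B] [IsScalarTower K B B] in
theorem IsGradedIso.symm (h : IsGradedIso 𝒜 ℬ) : IsGradedIso ℬ 𝒜 := by
  obtain ⟨φ, hmul, hmap⟩ := h
  refine ⟨φ.symm, fun a b => φ.injective (by simp [hmul]), fun g => ?_⟩
  rw [← hmap g, ← Submodule.map_comp]
  simp

theorem IsGradedIso.isGradedPI (h : IsGradedIso 𝒜 ℬ)
    {f : FreeNonUnitalNonAssocAlgebra K (ℕ × G)} (hf : IsGradedPI ℬ f) : IsGradedPI 𝒜 f := by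
  obtain ⟨φ, hmul, hmap⟩ := h
  intro e he
  let Φ : A →ₙₐ[K] B :=
    { toFun := φ
      map_smul' := map_smul φ
      map_zero' := map_zero φ
      map_add' := map_add φ
      map_mul' := hmul }
  have hcomp : Φ.comp (FreeNonUnitalNonAssocAlgebra.lift K e) =
      FreeNonUnitalNonAssocAlgebra.lift K (fun p => φ (e p)) := by
    refine FreeNonUnitalNonAssocAlgebra.hom_ext K fun p => ?_
    simp [Φ]
  apply φ.injective
  rw [map_zero, ← hf (fun p => φ (e p)) fun n g => by
    rw [← hmap g]
    exact Submodule.mem_map_of_mem (he n g)]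
  exact DFunLike.congr_fun hcomp f

variable [DecidableEq G] [DirectSum.Decomposition 𝒜] [DirectSum.Decomposition ℬ]
variable {ι : Type*} [Fintype ι] {deg : ι → G}

omit [SMulCommClass K A A] [IsScalarTower K A A] [SMulCommClass K B B] [IsScalarTower K B B]
  [DirectSum.Decomposition ℬ] in
theorem map_equiv_le (x : Module.Basis ι K A) (x' : Module.Basis ι K B)
    (hx : ∀ i, x i ∈ 𝒜 (deg i)) (hx' : ∀ i, x' i ∈ ℬ (deg i)) (g : G) :
    (𝒜 g).map (x.equiv x' (Equiv.refl ι) : A →ₗ[K] B) ≤ ℬ g := by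
  rintro _ ⟨u, hu, rfl⟩
  have hu' := hu
  rw [SetLike.mem_coe, ← x.sum_repr u] at hu'
  rw [LinearEquiv.coe_coe, ← x.sum_repr u, map_sum]
  refine sum_mem fun i _ => ?_
  rw [map_smul, Module.Basis.equiv_apply, Equiv.refl_apply]
  by_cases hi : deg i = g
  · exact Submodule.smul_mem _ _ (hi ▸ hx' i)
  · have : x.repr u i = 0 :=
      coeff_eq_zero 𝒜 hx x.linearIndependent (r := fun i => x.repr u i) hu' hi
    simp [this]

theorem isGradedIso_of_isStructure (x : Module.Basis ι K A) (x' : Module.Basis ι K B)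
    (hx : ∀ i, x i ∈ 𝒜 (deg i)) (hx' : ∀ i, x' i ∈ ℬ (deg i)) {c : ι × ι × ι → K}
    (hc : IsStructure x c) (hc' : IsStructure x' c) : IsGradedIso 𝒜 ℬ := by
  let e := x.equiv x' (Equiv.refl ι)
  refine ⟨e, fun u v => ?_, fun g => le_antisymm (map_equiv_le x x' hx hx' g) fun w hw => ?_⟩
  · have : (LinearMap.mul K A).compr₂ (e : A →ₗ[K] B) =
        (LinearMap.mul K B).compl₁₂ (e : A →ₗ[K] B) (e : A →ₗ[K] B) := by
      refine x.ext fun i => x.ext fun j => ?_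
      simp [e, hc i j, hc' i j]
    exact LinearMap.congr_fun₂ this u v
  · refine ⟨e.symm w, map_equiv_le x' x hx' hx g ⟨w, hw, ?_⟩, e.apply_symm_apply w⟩
    simp [e]

variable [DecidableEq ι] [Semigroup G]

theorem aeval_transform_eq_zero [IsAlgClosed K] [FiniteDimensional K A] [Nontrivial A]
    (hgrA : ∀ (g h : G), ∀ a ∈ 𝒜 g, ∀ b ∈ 𝒜 h, a * b ∈ 𝒜 (g * h))
    (hgrB : ∀ (g h : G), ∀ a ∈ ℬ g, ∀ b ∈ ℬ h, a * b ∈ ℬ (g * h))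
    (hA : IsGradedPrime 𝒜)
    (H : VanishingTransfers 𝒜 ℬ deg) (H' : VanishingTransfers ℬ 𝒜 deg)
    {a : Module.Basis ι K A} {b : Module.Basis ι K B}
    (ha : ∀ i, a i ∈ 𝒜 (deg i)) (hb : ∀ i, b i ∈ ℬ (deg i)) {cA cB : ι × ι × ι → K}
    (hcA : IsStructure a cA) (hcB : IsStructure b cB) {p : MvPolynomial (ι × ι × ι) K}
    (hp : MvPolynomial.aeval (transform cA (genericUnit K deg) (genericUnit K deg)⁻¹) p = 0) :
    MvPolynomial.aeval (transform cB (genericUnit K deg) (genericUnit K deg)⁻¹) p = 0 := by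
  obtain ⟨W, z, hz0, hz, hleaf⟩ := exists_words hgrA hA ha
  by_contra hne
  obtain ⟨β, hβ⟩ := exists_algHom_ne_zero K hne
  have key : ∀ (α : GenericRing K deg →ₐ[K] K) (c : ι × ι × ι → GenericRing K deg),
      α (MvPolynomial.aeval c p) = MvPolynomial.eval (fun t => α (c t)) p := fun α c => by
    rw [← AlgHom.comp_apply, MvPolynomial.comp_aeval]
    rfl
  obtain ⟨x', hx', hc'⟩ := exists_basis_of_algHom b hb hcB β
  rw [key] at hβ
  refine hβ (eval_eq_zero_of_vanishingTransfers hgrA hgrB H H' ha hz0 hz hleaf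
    (Module.finrank_eq_card_basis b).symm p (fun x hx c hc => ?_) x' hx' _ hc')
  obtain ⟨α, hα⟩ := exists_algHom_of_basis a ha hcA x hx hc
  have := key α (transform cA (genericUnit K deg) (genericUnit K deg)⁻¹)
  rw [hp, map_zero] at this
  simp only [hα] at this
  exact this.symm

omit [Fintype ι] [DecidableEq ι] in
theorem exists_linearIndependent_of_isGradedPI [IsAlgClosed K] [FiniteDimensional K A]
    [FiniteDimensional K B]
    (hgrA : ∀ (g h : G), ∀ a ∈ 𝒜 g, ∀ b ∈ 𝒜 h, a * b ∈ 𝒜 (g * h))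
    (hA : IsGradedPrime 𝒜)
    (h : ∀ f : FreeNonUnitalNonAssocAlgebra K (ℕ × G), IsGradedPI ℬ f → IsGradedPI 𝒜 f) :
    ∃ (deg : Fin (Module.finrank K A) → G) (a : Module.Basis (Fin (Module.finrank K A)) K A)
      (x : Fin (Module.finrank K A) → B), (∀ i, a i ∈ 𝒜 (deg i)) ∧ (∀ i, x i ∈ ℬ (deg i)) ∧
        LinearIndependent K x := by
  obtain ⟨deg, a, ha⟩ := exists_homogeneous_basis 𝒜
  rcases subsingleton_or_nontrivial A with hs | hn
  · have : IsEmpty (Fin (Module.finrank K A)) := by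
      rw [Module.finrank_zero_of_subsingleton]
      infer_instance
    exact ⟨deg, a, isEmptyElim, ha, isEmptyElim, linearIndependent_empty_type⟩
  · obtain ⟨W, z, hz0, hz, hleaf⟩ := exists_words hgrA hA ha
    have hι : Nonempty (Fin (Module.finrank K A)) := a.index_nonempty
    obtain ⟨x, -, hx, -, hli, -⟩ := exists_pow_ne_zero hι.some
      (vanishingTransfers_of_gradedPI h deg) ha hz0 hz hleaf 0
    exact ⟨deg, a, x, ha, hx, hli⟩

omit [Fintype ι] [DecidableEq ι] in
theorem isGradedIso_of_isGradedPI_iff [IsAlgClosed K] [FiniteDimensional K A]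
    [FiniteDimensional K B]
    (hgrA : ∀ (g h : G), ∀ a ∈ 𝒜 g, ∀ b ∈ 𝒜 h, a * b ∈ 𝒜 (g * h))
    (hgrB : ∀ (g h : G), ∀ a ∈ ℬ g, ∀ b ∈ ℬ h, a * b ∈ ℬ (g * h))
    (hA : IsGradedPrime 𝒜) (hB : IsGradedPrime ℬ)
    (h : ∀ f : FreeNonUnitalNonAssocAlgebra K (ℕ × G), IsGradedPI 𝒜 f ↔ IsGradedPI ℬ f) :
    IsGradedIso 𝒜 ℬ := by
  obtain ⟨deg, a, x, ha, hx, hli⟩ :=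
    exists_linearIndependent_of_isGradedPI (ℬ := ℬ) hgrA hA fun f => (h f).2
  obtain ⟨_, _, _, -, -, hli'⟩ :=
    exists_linearIndependent_of_isGradedPI (ℬ := 𝒜) hgrB hB fun f => (h f).1
  have hfin : Module.finrank K A = Module.finrank K B :=
    le_antisymm (by simpa using hli.fintype_card_le_finrank)
      (by simpa using hli'.fintype_card_le_finrank)
  rcases subsingleton_or_nontrivial A with hs | hn
  · have : Subsingleton B := by
      rw [← Module.finrank_zero_iff (R := K), ← hfin, Module.finrank_zero_of_subsingleton]
    exact ⟨0, fun _ _ => Subsingleton.elim _ _, fun _ => Subsingleton.elim _ _⟩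
  · have : Nontrivial B := by
      rw [← Module.finrank_pos_iff (R := K), ← hfin]
      exact Module.finrank_pos
    obtain ⟨b, rfl⟩ : ∃ b : Module.Basis (Fin (Module.finrank K A)) K B, ⇑b = x := by
      have hι : Nonempty (Fin (Module.finrank K A)) := a.index_nonempty
      have hcard : Fintype.card (Fin (Module.finrank K A)) = Module.finrank K B := by
        simpa using hfin
      exact ⟨_, coe_basisOfLinearIndependentOfCardEqFinrank hli hcard⟩
    have H := vanishingTransfers_of_gradedPI (fun f => (h f).1) deg
    have H' := vanishingTransfers_of_gradedPI (fun f => (h f).2) deg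
    have hcA : IsStructure a fun t => a.repr (a t.1 * a t.2.1) t.2.2 :=
      fun i j => (a.sum_repr (a i * a j)).symm
    have hcB : IsStructure b fun t => b.repr (b t.1 * b t.2.1) t.2.2 :=
      fun i j => (b.sum_repr (b i * b j)).symm
    obtain ⟨α, β, hαβ⟩ := exists_comp_eq_comp
      (MvPolynomial.aeval (R := K) (transform _ (genericUnit K deg) (genericUnit K deg)⁻¹))
      (MvPolynomial.aeval (R := K) (transform _ (genericUnit K deg) (genericUnit K deg)⁻¹))
      fun p => ⟨aeval_transform_eq_zero hgrA hgrB hA H H' ha hx hcA hcB,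
        aeval_transform_eq_zero hgrB hgrA hB H' H hx ha hcB hcA⟩
    obtain ⟨y, hy, hc⟩ := exists_basis_of_algHom a ha hcA α
    obtain ⟨y', hy', hc'⟩ := exists_basis_of_algHom b hx hcB β
    refine isGradedIso_of_isStructure y y' hy hy' hc ?_
    convert hc' using 2 with t
    simpa using hαβ (MvPolynomial.X t)

end Main

end GradedPrime

theorem gradedPrime_iso_iff_same_gradedIdentities
    (K G A B : Type*) [Field K] [IsAlgClosed K] [Semigroup G] [DecidableEq G]
    [NonUnitalNonAssocRing A] [Module K A] [SMulCommClass K A A] [IsScalarTower K A A]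
    [FiniteDimensional K A]
    [NonUnitalNonAssocRing B] [Module K B] [SMulCommClass K B B] [IsScalarTower K B B]
    [FiniteDimensional K B]
    (𝒜 : G → Submodule K A) (ℬ : G → Submodule K B)
    [DirectSum.Decomposition 𝒜] [DirectSum.Decomposition ℬ]
    (hgrA : ∀ (g h : G), ∀ a ∈ 𝒜 g, ∀ b ∈ 𝒜 h, a * b ∈ 𝒜 (g * h))
    (hgrB : ∀ (g h : G), ∀ a ∈ ℬ g, ∀ b ∈ ℬ h, a * b ∈ ℬ (g * h))
    (hA : IsGradedPrime 𝒜) (hB : IsGradedPrime ℬ) :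
    IsGradedIso 𝒜 ℬ ↔
      (∀ f : FreeNonUnitalNonAssocAlgebra K (ℕ × G), IsGradedPI 𝒜 f ↔ IsGradedPI ℬ f) := by

  refine ⟨fun h f => ⟨fun hf => ?_, fun hf => ?_⟩, fun h => ?_⟩
  · exact GradedPrime.IsGradedIso.isGradedPI (GradedPrime.IsGradedIso.symm h) hf
  · exact GradedPrime.IsGradedIso.isGradedPI h hf
  · exact GradedPrime.isGradedIso_of_isGradedPI_iff hgrA hgrB hA hB h
end
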